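/- arXiv:2502.10981 — 4 statements merged into one kernel-verified Lean document; each statement's English description precedes it below -/
import Mathlib

section
/- For every integer d ≥ 1 and every integer k ≥ 2, the minimum forcing number of the Cartesian product of the d-dimensional hypercube with the cycle on 2k vertices satisfies f(Q_d □ C_{2k}) = 2^d. -/
open SimpleGraph

noncomputable def forcingNumber {V : Type*} (G : SimpleGraph V) (M : G.Subgraph) : ℕ :=
  sInf {c | ∃ S : Set (Sym2 V), S ⊆ M.edgeSet ∧ S.ncard = c ∧
    ∀ M' : G.Subgraph, M'.IsPerfectMatching → S ⊆ M'.edgeSet → M' = M}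

noncomputable def minForcingNumber {V : Type*} (G : SimpleGraph V) : ℕ :=
  sInf {c | ∃ M : G.Subgraph, M.IsPerfectMatching ∧ forcingNumber G M = c}


def hypercube (d : ℕ) : SimpleGraph (Fin d → Bool) :=
  SimpleGraph.fromRel (fun u v => (Finset.univ.filter (fun i => u i ≠ v i)).card = 1)

namespace HypercubeCycle

section Matching

variable {V : Type*} {G : SimpleGraph V}

/-- The subgraph whose edges join each vertex to its image under an involution. -/
def involutionSubgraph (G : SimpleGraph V) (p : V → V) (hp : Function.Involutive p)
    (hadj : ∀ v, G.Adj v (p v)) : G.Subgraph where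
  verts := Set.univ
  Adj v w := p v = w
  adj_sub := by
    rintro v _ rfl
    exact hadj v
  edge_vert _ := Set.mem_univ _
  symm := ⟨by
    rintro v _ rfl
    exact hp v⟩

theorem involutionSubgraph_isPerfectMatching (p : V → V) (hp : Function.Involutive p)
    (hadj : ∀ v, G.Adj v (p v)) :
    (involutionSubgraph G p hp hadj).IsPerfectMatching := by
  rw [Subgraph.isPerfectMatching_iff]
  exact fun v => ⟨p v, rfl, fun _ h => Eq.symm h⟩

theorem exists_involution_of_isPerfectMatching {M : G.Subgraph} (hM : M.IsPerfectMatching) :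
    ∃ p : V → V, Function.Involutive p ∧ ∀ v w, M.Adj v w ↔ p v = w := by
  choose p hp hu using Subgraph.isPerfectMatching_iff.1 hM
  refine ⟨p, fun v => (hu (p v) v (hp v).symm).symm, fun v w => ⟨fun h => (hu v w h).symm, ?_⟩⟩
  rintro rfl
  exact hp v

theorem eq_of_isPerfectMatching_of_adj {M M' : G.Subgraph} (hM : M.IsPerfectMatching)
    (hM' : M'.IsPerfectMatching) (h : ∀ v w, M.Adj v w → M'.Adj v w) : M' = M := by
  obtain ⟨p, -, hp⟩ := exists_involution_of_isPerfectMatching hM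
  obtain ⟨p', -, hp'⟩ := exists_involution_of_isPerfectMatching hM'
  have hpp (v : V) : p' v = p v := (hp' _ _).1 (h v (p v) ((hp _ _).2 rfl))
  refine Subgraph.ext ?_ ?_
  · rw [Subgraph.isSpanning_iff.1 hM.2, Subgraph.isSpanning_iff.1 hM'.2]
  · ext v w
    rw [hp', hp, hpp]

/-- In a graph with a proper two-coloring, switching a matching along an alternating cycle that
only uses edges with an end in `T`. -/
theorem exists_switched_involution [Finite V] (col : V → Bool)
    (hcol : ∀ u v, G.Adj u v → col u ≠ col v) (p : V → V) (hp : Function.Involutive p)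
    (hadj : ∀ v, G.Adj v (p v)) (T : Set V) (hT : T.Nonempty)
    (hstep : ∀ v ∈ T, ∃ w ∈ T, w ≠ v ∧ G.Adj w (p v)) :
    ∃ p' : V → V, Function.Involutive p' ∧ (∀ v, G.Adj v (p' v)) ∧ p' ≠ p ∧
      ∀ v, v ∉ T → p v ∉ T → p' v = p v := by
  classical
  obtain ⟨v₀, hv₀⟩ := hT
  have hstep' : ∀ v, ∃ w, v ∈ T → w ∈ T ∧ w ≠ v ∧ G.Adj w (p v) := fun v => by
    by_cases hv : v ∈ T
    · obtain ⟨w, hw⟩ := hstep v hv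
      exact ⟨w, fun _ => hw⟩
    · exact ⟨v, fun h => absurd h hv⟩
  choose f hf using hstep'
  have hiter (n : ℕ) : f^[n] v₀ ∈ T := by
    induction n with
    | zero => exact hv₀
    | succ n ih =>
      rw [Function.iterate_succ_apply']
      exact (hf _ ih).1
  obtain ⟨v, hvT, n, hn⟩ : ∃ v, (∀ m, f^[m] v ∈ T) ∧ ∃ n, f^[n + 1] v = v := by
    obtain ⟨a, b, hab, he⟩ :=
      Finite.exists_ne_map_eq_of_infinite (fun n : ℕ => f^[n] v₀)
    wlog hlt : a < b generalizing a b
    · exact this b a hab.symm he.symm (by omega)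
    refine ⟨f^[a] v₀, fun m => ?_, b - a - 1, ?_⟩
    · rw [← Function.iterate_add_apply]
      exact hiter _
    · rw [← Function.iterate_add_apply, show b - a - 1 + 1 + a = b by omega]
      exact he.symm
  let C : Set V := Set.range fun m => f^[m] v
  let g : V → V := f^[n]
  have hCT {x : V} (hx : x ∈ C) : x ∈ T := by
    obtain ⟨m, rfl⟩ := hx
    exact hvT m
  have hCf {x : V} (hx : x ∈ C) : f x ∈ C := by
    obtain ⟨m, rfl⟩ := hx
    exact ⟨m + 1, Function.iterate_succ_apply' f m v⟩
  have hCg {x : V} (hx : x ∈ C) : g x ∈ C := by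
    obtain ⟨m, rfl⟩ := hx
    exact ⟨n + m, Function.iterate_add_apply f n m v⟩
  have hper {x : V} (hx : x ∈ C) : f^[n + 1] x = x := by
    obtain ⟨m, rfl⟩ := hx
    change f^[n + 1] (f^[m] v) = f^[m] v
    rw [← Function.iterate_add_apply, Nat.add_comm, Function.iterate_add_apply, hn]
  have hfg {x : V} (hx : x ∈ C) : f (g x) = x := by
    rw [← Function.iterate_succ_apply' f n x, hper hx]
  have hgf {x : V} (hx : x ∈ C) : g (f x) = x := by
    exact (Function.iterate_succ_apply f n x).symm.trans (hper hx)
  have hcolC {x : V} (hx : x ∈ C) : col x = col v := by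
    obtain ⟨m, rfl⟩ := hx
    induction m with
    | zero => rfl
    | succ m ih =>
      have h₁ := hcol _ _ (hf _ (hvT m)).2.2
      have h₂ := hcol _ _ (hadj (f^[m] v))
      simp only [Function.iterate_succ_apply'] at ih ⊢
      rw [← ih]
      revert h₁ h₂
      generalize col (f (f^[m] v)) = a
      generalize col (f^[m] v) = b
      generalize col (p (f^[m] v)) = c
      revert a b c
      decide
  have hpC {x : V} (hx : x ∈ C) : p x ∉ C := fun h =>
    hcol _ _ (hadj x) ((hcolC hx).trans (hcolC h).symm)
  let p' : V → V := fun x => if x ∈ C then p (g x) else if p x ∈ C then f (p x) else p x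
  have hp'C {x : V} (hx : x ∈ C) : p' x = p (g x) := if_pos hx
  have hp'pC {x : V} (hx : x ∉ C) (hpx : p x ∈ C) : p' x = f (p x) := by
    simp only [p', if_neg hx, if_pos hpx]
  have hp'off {x : V} (hx : x ∉ C) (hpx : p x ∉ C) : p' x = p x := by
    simp only [p', if_neg hx, if_neg hpx]
  have hvC : v ∈ C := ⟨0, rfl⟩
  refine ⟨p', fun x => ?_, fun x => ?_, fun h => ?_, fun x hx hpx =>
    hp'off (fun h => hx (hCT h)) fun h => hpx (hCT h)⟩
  · by_cases hx : x ∈ C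
    · rw [hp'C hx, hp'pC (hpC (hCg hx)) (by rw [hp]; exact hCg hx), hp, hfg hx]
    · by_cases hpx : p x ∈ C
      · rw [hp'pC hx hpx, hp'C (hCf hpx), hgf hpx, hp]
      · rw [hp'off hx hpx, hp'off hpx (by rwa [hp]), hp]
  · by_cases hx : x ∈ C
    · have h := (hf _ (hCT (hCg hx))).2.2
      rw [hfg hx] at h
      rwa [hp'C hx]
    · by_cases hpx : p x ∈ C
      · have h := (hf _ (hCT hpx)).2.2
        rw [hp] at h
        rw [hp'pC hx hpx]
        exact h.symm
      · rw [hp'off hx hpx]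
        exact hadj x
  · have h₁ : p (g v) = p v := by rw [← hp'C hvC, h]
    have h₂ : g v = v := hp.injective h₁
    have h₃ := hfg hvC
    rw [h₂] at h₃
    exact (hf v (hCT hvC)).2.1 h₃

/-- A space of functions none of which is supported on exactly one neighbor of some vertex bounds
the size of forcing sets in bipartite graphs from below. -/
theorem finrank_le_two_mul_ncard_of_forcing [Finite V] {K : Type*} [Field K] (col : V → Bool)
    (hcol : ∀ u v, G.Adj u v → col u ≠ col v) (W : Submodule K (V → K))
    (hW : ∀ x ∈ W, ∀ u v, G.Adj v u → x v ≠ 0 → ∃ w, w ≠ v ∧ G.Adj w u ∧ x w ≠ 0)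
    {M : G.Subgraph} (hM : M.IsPerfectMatching) {S : Set (Sym2 V)} (hS : S ⊆ M.edgeSet)
    (hforce : ∀ M' : G.Subgraph, M'.IsPerfectMatching → S ⊆ M'.edgeSet → M' = M) :
    Module.finrank K W ≤ 2 * S.ncard := by
  classical
  have := Fintype.ofFinite V
  obtain ⟨p, hp, hMp⟩ := exists_involution_of_isPerfectMatching hM
  have hadj (v : V) : G.Adj v (p v) := M.adj_sub ((hMp _ _).2 rfl)
  by_contra! hlt
  let ends : S → Bool → V := fun e b => if b then e.1.out.1 else e.1.out.2
  let restrict : W →ₗ[K] (S × Bool → K) :=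
    { toFun := fun x i => x.1 (ends i.1 i.2)
      map_add' := fun _ _ => rfl
      map_smul' := fun _ _ => rfl }
  have hdim : Module.finrank K (S × Bool → K) < Module.finrank K W := by
    rw [Module.finrank_fintype_fun_eq_card, Fintype.card_prod, Fintype.card_bool,
      ← Nat.card_eq_fintype_card, Nat.card_coe_set_eq]
    omega
  obtain ⟨x, hx, hx0⟩ := Submodule.exists_mem_ne_zero_of_ne_bot
    (LinearMap.ker_ne_bot_of_finrank_lt (f := restrict) hdim)
  have hxS (v w : V) (h : s(v, w) ∈ S) : x.1 v = 0 := by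
    have h₁ : x.1 (ends ⟨_, h⟩ true) = 0 := congrFun (LinearMap.mem_ker.1 hx) (⟨_, h⟩, true)
    have h₂ : x.1 (ends ⟨_, h⟩ false) = 0 := congrFun (LinearMap.mem_ker.1 hx) (⟨_, h⟩, false)
    have hout : s(s(v, w).out.1, s(v, w).out.2) = s(v, w) := Quot.out_eq s(v, w)
    simp only [ends, if_true, Bool.false_eq_true, if_false] at h₁ h₂
    rcases Sym2.eq_iff.1 hout with ⟨ha, -⟩ | ⟨-, hb⟩
    · rwa [ha] at h₁
    · rwa [hb] at h₂
  have hne : {v | x.1 v ≠ 0}.Nonempty := by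
    by_contra! h
    exact hx0 (Subtype.ext (funext fun v => by
      by_contra hv
      exact (Set.eq_empty_iff_forall_notMem.1 h v) hv))
  obtain ⟨p', hp', hadj', hpp', hoff⟩ := exists_switched_involution col hcol p hp hadj
    {v | x.1 v ≠ 0} hne fun v hv => by
      obtain ⟨w, hwv, hw, hxw⟩ := hW x.1 x.2 (p v) v (hadj v) hv
      exact ⟨w, hxw, hwv, hw⟩
  have hM' := hforce _ (involutionSubgraph_isPerfectMatching p' hp' hadj') fun e he => by
    induction e with
    | h v w =>
      have hvw : p v = w := (hMp _ _).1 (hS he)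
      have hw : s(w, v) ∈ S := by rwa [Sym2.eq_swap]
      change p' v = w
      rw [hoff v (by simpa using hxS v w he) (by simpa [hvw] using hxS w v hw), hvw]
  refine hpp' (funext fun v => ?_)
  have h : (involutionSubgraph G p' hp' hadj').Adj v (p' v) := rfl
  rw [hM'] at h
  exact ((hMp _ _).1 h).symm

theorem minForcingNumber_eq {m : ℕ} (hle : ∀ M : G.Subgraph, M.IsPerfectMatching →
      ∀ S ⊆ M.edgeSet, (∀ M' : G.Subgraph, M'.IsPerfectMatching → S ⊆ M'.edgeSet → M' = M) →
        m ≤ S.ncard)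
    (hex : ∃ M : G.Subgraph, M.IsPerfectMatching ∧ ∃ S ⊆ M.edgeSet, S.ncard ≤ m ∧
      ∀ M' : G.Subgraph, M'.IsPerfectMatching → S ⊆ M'.edgeSet → M' = M) :
    minForcingNumber G = m := by
  obtain ⟨M, hM, S, hS, hSm, hforce⟩ := hex
  apply le_antisymm
  · have h₁ : minForcingNumber G ≤ forcingNumber G M := Nat.sInf_le ⟨M, hM, rfl⟩
    have h₂ : forcingNumber G M ≤ S.ncard := Nat.sInf_le ⟨S, hS, rfl, hforce⟩
    exact h₁.trans (h₂.trans hSm)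
  · refine le_csInf ⟨_, M, hM, rfl⟩ ?_
    rintro _ ⟨N, hN, rfl⟩
    refine le_csInf ⟨_, N.edgeSet, subset_rfl, rfl, fun N' hN' h =>
      eq_of_isPerfectMatching_of_adj hN hN' fun v w hvw =>
        Subgraph.mem_edgeSet.1 (h (Subgraph.mem_edgeSet.2 hvw))⟩ ?_
    rintro _ ⟨S, hS, rfl, hforce⟩
    exact hle N hN S hS hforce

end Matching

section Cube

variable {d : ℕ}

/-- The vertex of the hypercube obtained by changing one coordinate. -/
def flip (q : Fin d → Bool) (i : Fin d) : Fin d → Bool := Function.update q i (!q i)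

@[simp]
theorem flip_same (q : Fin d → Bool) (i : Fin d) : flip q i i = !q i := by simp [flip]

theorem flip_of_ne (q : Fin d → Bool) {i j : Fin d} (h : j ≠ i) : flip q i j = q j := by
  simp [flip, h]

theorem flip_ne (q : Fin d → Bool) (i : Fin d) : flip q i ≠ q := fun h => by
  simpa using congrFun h i

theorem flip_flip (q : Fin d → Bool) (i : Fin d) : flip (flip q i) i = q := by
  simp [flip]

theorem flip_comm (q : Fin d → Bool) {i j : Fin d} (h : i ≠ j) :
    flip (flip q i) j = flip (flip q j) i := by
  unfold flip
  rw [Function.update_of_ne h, Function.update_of_ne h.symm, Function.update_comm h]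

theorem flip_injective (q : Fin d → Bool) : Function.Injective (flip q) := fun i j h => by
  by_contra hij
  have := congrFun h i
  rw [flip_same, flip_of_ne q hij] at this
  simp at this

theorem hypercube_adj_iff {u v : Fin d → Bool} :
    (hypercube d).Adj u v ↔ ∃ i, v = flip u i := by
  have key (u v : Fin d → Bool) :
      (Finset.univ.filter (fun i => u i ≠ v i)).card = 1 ↔ ∃ i, v = flip u i := by
    rw [Finset.card_eq_one]
    refine exists_congr fun i => ⟨fun h => funext fun j => ?_, ?_⟩
    · have hj := Finset.ext_iff.1 h j
      simp only [Finset.mem_filter, Finset.mem_univ, true_and, Finset.mem_singleton] at hj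
      by_cases hji : j = i
      · subst hji
        rw [flip_same]
        have := hj.2 rfl
        revert this
        cases u j <;> cases v j <;> simp
      · rw [flip_of_ne u hji]
        exact (not_not.1 (mt hj.1 hji)).symm
    · rintro rfl
      ext j
      by_cases hji : j = i
      · subst hji
        simp
      · simp [flip_of_ne u hji, hji]
  rw [hypercube, fromRel_adj, key, key]
  constructor
  · rintro ⟨-, h | ⟨i, rfl⟩⟩
    · exact h
    · exact ⟨i, (flip_flip v i).symm⟩
  · rintro ⟨i, rfl⟩
    exact ⟨(flip_ne u i).symm, Or.inl ⟨i, rfl⟩⟩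

/-- The number of true coordinates modulo two. -/
def parity (q : Fin d → Bool) : ZMod 2 := ∑ j, if q j then 1 else 0

theorem parity_flip (q : Fin d → Bool) (i : Fin d) : parity (flip q i) = parity q + 1 := by
  unfold parity
  rw [← Finset.add_sum_erase _ _ (Finset.mem_univ i), ← Finset.add_sum_erase Finset.univ
    (fun j => if q j then (1 : ZMod 2) else 0) (Finset.mem_univ i),
    Finset.sum_congr rfl fun j hj => by rw [flip_of_ne q (Finset.ne_of_mem_erase hj)],
    flip_same]
  generalize (∑ x ∈ Finset.univ.erase i, if q x then (1 : ZMod 2) else 0) = a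
  cases q i <;> revert a <;> decide

/-- The sign of the edge in direction `i` at `q` in the Huang signing of the hypercube. -/
def edgeSign (i : Fin d) (q : Fin d → Bool) : ℚ :=
  ∏ j, if j < i ∧ q j then -1 else 1

theorem edgeSign_ne_zero (i : Fin d) (q : Fin d → Bool) : edgeSign i q ≠ 0 :=
  Finset.prod_ne_zero_iff.2 fun j _ => by split_ifs <;> norm_num

theorem edgeSign_mul_self (i : Fin d) (q : Fin d → Bool) : edgeSign i q * edgeSign i q = 1 := by
  rw [edgeSign, ← Finset.prod_mul_distrib]
  exact Finset.prod_eq_one fun j _ => by split_ifs <;> norm_num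

theorem edgeSign_flip_of_le {i j : Fin d} (h : i ≤ j) (q : Fin d → Bool) :
    edgeSign i (flip q j) = edgeSign i q := by
  refine Finset.prod_congr rfl fun l _ => ?_
  by_cases hl : l < i
  · rw [flip_of_ne q (hl.trans_le h).ne]
  · simp [hl]

theorem edgeSign_flip_of_lt {i j : Fin d} (h : i < j) (q : Fin d → Bool) :
    edgeSign j (flip q i) = -edgeSign j q := by
  unfold edgeSign
  rw [← Finset.mul_prod_erase _ _ (Finset.mem_univ i), ← Finset.mul_prod_erase Finset.univ
    (fun l => if l < j ∧ q l then (-1 : ℚ) else 1) (Finset.mem_univ i),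
    Finset.prod_congr rfl fun l hl => by rw [flip_of_ne q (Finset.ne_of_mem_erase hl)],
    flip_same, ← neg_mul]
  congr 1
  cases q i <;> simp [h]

/-- The Huang signed adjacency operator of the hypercube. -/
def signedAdj : ((Fin d → Bool) → ℚ) →ₗ[ℚ] ((Fin d → Bool) → ℚ) where
  toFun f q := ∑ i, edgeSign i q * f (flip q i)
  map_add' f g := by
    ext q
    simp [mul_add, Finset.sum_add_distrib]
  map_smul' c f := by
    ext q
    simp [Finset.mul_sum, mul_left_comm]

theorem signedAdj_apply (f : (Fin d → Bool) → ℚ) (q : Fin d → Bool) :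
    signedAdj f q = ∑ i, edgeSign i q * f (flip q i) := rfl

theorem edgeSign_mul_flip_antisymm (q : Fin d → Bool) {i j : Fin d} (h : i ≠ j) :
    edgeSign i q * edgeSign j (flip q i) = -(edgeSign j q * edgeSign i (flip q j)) := by
  rcases lt_or_gt_of_ne h with h | h
  · rw [edgeSign_flip_of_lt h, edgeSign_flip_of_le h.le]
    ring
  · rw [edgeSign_flip_of_lt h, edgeSign_flip_of_le h.le]
    ring

theorem signedAdj_signedAdj (f : (Fin d → Bool) → ℚ) :
    signedAdj (signedAdj f) = (d : ℚ) • f := by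
  ext q
  have hexp : signedAdj (signedAdj f) q = ∑ i, ∑ j,
      edgeSign i q * edgeSign j (flip q i) * f (flip (flip q i) j) := by
    simp only [signedAdj_apply, Finset.mul_sum, mul_assoc]
  set F : Fin d → Fin d → ℚ := fun i j =>
    edgeSign i q * edgeSign j (flip q i) * f (flip (flip q i) j) with hF
  have hdiag (i : Fin d) : F i i = f q := by
    simp only [hF]
    rw [edgeSign_flip_of_le le_rfl, edgeSign_mul_self, flip_flip, one_mul]
  have hanti (i j : Fin d) : F i j + F j i = if i = j then 2 * f q else 0 := by
    split_ifs with h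
    · rw [h, hdiag]
      ring
    · simp only [hF]
      rw [edgeSign_mul_flip_antisymm q h, flip_comm q h]
      ring
  have htwo : 2 * ∑ i, ∑ j, F i j = 2 * (d * f q) := by
    calc 2 * ∑ i, ∑ j, F i j = ∑ i, ∑ j, F i j + ∑ i, ∑ j, F j i := by
          rw [Finset.sum_comm (f := fun i j => F j i), two_mul]
      _ = ∑ i, ∑ j, (F i j + F j i) := by simp only [Finset.sum_add_distrib]
      _ = 2 * (d * f q) := by
          simp only [hanti, Finset.sum_ite_eq, Finset.mem_univ, if_true, Finset.sum_const,
            Finset.card_univ, Fintype.card_fin, nsmul_eq_mul]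
          ring
  rw [hexp, Pi.smul_apply, smul_eq_mul]
  linarith

/-- The identity at even positions and the signed adjacency operator at odd positions. -/
def layerMap (n : ℕ) : ((Fin d → Bool) → ℚ) →ₗ[ℚ] ((Fin d → Bool) → ℚ) :=
  if Even n then LinearMap.id else signedAdj

theorem layerMap_congr {m n : ℕ} (h : Even m ↔ Even n) :
    layerMap (d := d) m = layerMap n := by
  simp only [layerMap, h]

theorem exists_signedAdj_layerMap (hd : 1 ≤ d) (n : ℕ) :
    ∃ c : ℚ, c ≠ 0 ∧ ∀ f : (Fin d → Bool) → ℚ,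
      signedAdj (layerMap n f) = c • layerMap (n + 1) f := by
  by_cases h : Even n
  · refine ⟨1, one_ne_zero, fun f => ?_⟩
    simp [layerMap, h, Nat.even_add_one]
  · refine ⟨d, Nat.cast_ne_zero.2 (by omega), fun f => ?_⟩
    simp [layerMap, h, Nat.even_add_one, signedAdj_signedAdj]

end Cube

section Cycle

theorem cycleGraph_adj_iff {N : ℕ} [NeZero N] (hN : 2 ≤ N) {i j : Fin N} :
    (cycleGraph N).Adj i j ↔ j = i + 1 ∨ j = i - 1 := by
  have hone : ((1 : Fin N) : ℕ) = 1 := by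
    rw [Fin.val_one', Nat.mod_eq_of_lt (by omega)]
  have hval (a : Fin N) : a.val = 1 ↔ a = 1 := by rw [Fin.ext_iff, hone]
  rw [cycleGraph_adj', hval, hval, or_comm, sub_eq_iff_eq_add, sub_eq_iff_eq_add, add_comm 1 i,
    eq_sub_iff_add_eq, add_comm 1 j, eq_comm (a := j + 1)]

theorem val_add_one_eq {N : ℕ} [NeZero N] (hN : 2 ≤ N) (i : Fin N) :
    (i + 1).val = if i.val + 1 = N then 0 else i.val + 1 := by
  have hone : ((1 : Fin N) : ℕ) = 1 := by
    rw [Fin.val_one', Nat.mod_eq_of_lt (by omega)]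
  rw [Fin.val_add, hone]
  split_ifs with h
  · rw [h, Nat.mod_self]
  · exact Nat.mod_eq_of_lt (by have := i.isLt; omega)

theorem val_sub_one_eq {N : ℕ} [NeZero N] (hN : 2 ≤ N) (i : Fin N) :
    (i - 1).val = if i.val = 0 then N - 1 else i.val - 1 := by
  have h := val_add_one_eq hN (i - 1)
  rw [sub_add_cancel] at h
  have := (i - 1).isLt
  split_ifs at h ⊢ <;> omega

variable {k : ℕ} [NeZero (2 * k)]

theorem cast_val_add_one (hk : 1 ≤ k) (i : Fin (2 * k)) :
    ((i + 1).val : ZMod 2) = i.val + 1 := by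
  rw [val_add_one_eq (by omega)]
  split_ifs with h
  · have h' : ((i.val + 1 : ℕ) : ZMod 2) = (2 * k : ℕ) := by rw [h]
    push_cast at h'
    rw [h', Nat.cast_zero, show (2 : ZMod 2) = 0 from rfl, zero_mul]
  · push_cast
    rfl

theorem cast_val_sub_one (hk : 1 ≤ k) (i : Fin (2 * k)) :
    ((i - 1).val : ZMod 2) = i.val + 1 := by
  have h := cast_val_add_one hk (i - 1)
  rw [sub_add_cancel] at h
  rw [h, add_assoc, show (1 + 1 : ZMod 2) = 0 from rfl, add_zero]

end Cycle

section Product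

variable {d k : ℕ}

/-- The class of a vertex in the bipartition of the product. -/
def vertexParity (v : (Fin d → Bool) × Fin (2 * k)) : ZMod 2 := parity v.1 + (v.2.val : ZMod 2)

theorem vertexParity_flip (v : (Fin d → Bool) × Fin (2 * k)) (j : Fin d) :
    vertexParity (flip v.1 j, v.2) = vertexParity v + 1 := by
  simp only [vertexParity, parity_flip]
  ring

/-- The functions on the product that are affine along the cycle, twisted by the signed adjacency
operator at odd positions. -/
def affineLayers (d k : ℕ) : ((Fin d → Bool) → ℚ) × ((Fin d → Bool) → ℚ) →ₗ[ℚ]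
    ((Fin d → Bool) × Fin (2 * k) → ℚ) where
  toFun f v := layerMap v.2.val f.1 v.1 + (v.2.val : ℚ) * layerMap v.2.val f.2 v.1
  map_add' f g := by
    ext v
    simp only [Prod.fst_add, Prod.snd_add, map_add, Pi.add_apply]
    ring
  map_smul' c f := by
    ext v
    simp only [Prod.smul_fst, Prod.smul_snd, map_smul, Pi.smul_apply, smul_eq_mul,
      RingHom.id_apply]
    ring

theorem affineLayers_apply (f : ((Fin d → Bool) → ℚ) × ((Fin d → Bool) → ℚ))
    (v : (Fin d → Bool) × Fin (2 * k)) :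
    affineLayers d k f v =
      layerMap v.2.val f.1 v.1 + (v.2.val : ℚ) * layerMap v.2.val f.2 v.1 := rfl

theorem affineLayers_injective (hk : 2 ≤ k) : Function.Injective (affineLayers d k) := by
  refine (injective_iff_map_eq_zero _).2 fun f hf => ?_
  have h₀ (q) : f.1 q = 0 := by
    simpa [affineLayers_apply, layerMap] using congrFun hf (q, ⟨0, by omega⟩)
  have h₂ (q) : f.2 q = 0 := by
    simpa [affineLayers_apply, layerMap, h₀] using congrFun hf (q, ⟨2, by omega⟩)
  exact Prod.ext (funext h₀) (funext h₂)

theorem finrank_range_affineLayers (hk : 2 ≤ k) :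
    Module.finrank ℚ (LinearMap.range (affineLayers d k)) = 2 * 2 ^ d := by
  rw [LinearMap.finrank_range_of_inj (affineLayers_injective hk), Module.finrank_prod,
    Module.finrank_fintype_fun_eq_card]
  simp [two_mul]

theorem exists_sum_affineLayers (hd : 1 ≤ d) (f : ((Fin d → Bool) → ℚ) × ((Fin d → Bool) → ℚ))
    (q : Fin d → Bool) (i : Fin (2 * k)) :
    ∃ c : ℚ, c ≠ 0 ∧ ∑ j, edgeSign j q * affineLayers d k f (flip q j, i) =
      c * (layerMap (i.val + 1) f.1 q + (i.val : ℚ) * layerMap (i.val + 1) f.2 q) := by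
  obtain ⟨c, hc, h⟩ := exists_signedAdj_layerMap hd i.val
  refine ⟨c, hc, ?_⟩
  have h₁ := congrFun (h f.1) q
  have h₂ := congrFun (h f.2) q
  simp only [signedAdj_apply, Pi.smul_apply, smul_eq_mul] at h₁ h₂
  rw [mul_add, mul_left_comm, ← h₁, ← h₂, Finset.mul_sum, ← Finset.sum_add_distrib]
  refine Finset.sum_congr rfl fun j _ => ?_
  rw [affineLayers_apply]
  ring

theorem eq_zero_of_add_mul_eq_zero {a b x y : ℚ} (hab : a ≠ b) (ha : x + a * y = 0)
    (hb : x + b * y = 0) : x = 0 ∧ y = 0 := by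
  have hy : y = 0 := by
    have : (a - b) * y = 0 := by linear_combination ha - hb
    exact (mul_eq_zero.1 this).resolve_left (sub_ne_zero.2 hab)
  refine ⟨?_, hy⟩
  simpa [hy] using ha

variable [NeZero (2 * k)]

theorem boxProd_adj_iff (hk : 2 ≤ k) {u v : (Fin d → Bool) × Fin (2 * k)} :
    (hypercube d □ cycleGraph (2 * k)).Adj u v ↔
      (∃ j, v = (flip u.1 j, u.2)) ∨ v = (u.1, u.2 + 1) ∨ v = (u.1, u.2 - 1) := by
  rw [boxProd_adj, hypercube_adj_iff, cycleGraph_adj_iff (by omega)]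
  obtain ⟨q, i⟩ := u
  obtain ⟨q', i'⟩ := v
  simp only [Prod.mk.injEq]
  constructor
  · rintro (⟨⟨j, rfl⟩, rfl⟩ | ⟨rfl | rfl, rfl⟩) <;> simp
  · rintro (⟨j, rfl, rfl⟩ | ⟨rfl, rfl⟩ | ⟨rfl, rfl⟩) <;> simp

theorem vertexParity_add_one (hk : 1 ≤ k) (v : (Fin d → Bool) × Fin (2 * k)) :
    vertexParity (v.1, v.2 + 1) = vertexParity v + 1 := by
  simp only [vertexParity, cast_val_add_one hk]
  ring

theorem vertexParity_sub_one (hk : 1 ≤ k) (v : (Fin d → Bool) × Fin (2 * k)) :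
    vertexParity (v.1, v.2 - 1) = vertexParity v + 1 := by
  simp only [vertexParity, cast_val_sub_one hk]
  ring

theorem vertexParity_of_adj (hk : 2 ≤ k) {u v : (Fin d → Bool) × Fin (2 * k)}
    (h : (hypercube d □ cycleGraph (2 * k)).Adj u v) : vertexParity v = vertexParity u + 1 := by
  rcases (boxProd_adj_iff hk).1 h with ⟨j, rfl⟩ | rfl | rfl
  · exact vertexParity_flip u j
  · exact vertexParity_add_one (by omega) u
  · exact vertexParity_sub_one (by omega) u

theorem affineLayers_exists_other_neighbor (hd : 1 ≤ d) (hk : 2 ≤ k)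
    (f : ((Fin d → Bool) → ℚ) × ((Fin d → Bool) → ℚ)) (u v : (Fin d → Bool) × Fin (2 * k))
    (hvu : (hypercube d □ cycleGraph (2 * k)).Adj v u) (hv : affineLayers d k f v ≠ 0) :
    ∃ w, w ≠ v ∧ (hypercube d □ cycleGraph (2 * k)).Adj w u ∧ affineLayers d k f w ≠ 0 := by
  obtain ⟨q, i⟩ := u
  by_contra! hall
  have hzero (w) (hw : w ≠ v) (h : (hypercube d □ cycleGraph (2 * k)).Adj (q, i) w) :
      affineLayers d k f w = 0 := hall w hw h.symm
  obtain ⟨c, hc, hsum⟩ := exists_sum_affineLayers hd f q i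
  have hi := i.isLt
  have hnext := val_add_one_eq (by omega) i
  have hprev := val_sub_one_eq (by omega) i
  have hne₁ : (((i + 1).val : ℕ) : ℚ) ≠ i.val :=
    Nat.cast_injective.ne (by split_ifs at hnext <;> omega)
  have hne₂ : (((i - 1).val : ℕ) : ℚ) ≠ i.val :=
    Nat.cast_injective.ne (by split_ifs at hprev <;> omega)
  have hne : (i + 1).val ≠ (i - 1).val := by
    split_ifs at hnext hprev <;> omega
  have hval₁ : affineLayers d k f (q, i + 1) =
      layerMap (i.val + 1) f.1 q + ((i + 1).val : ℚ) * layerMap (i.val + 1) f.2 q := by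
    rw [affineLayers_apply, layerMap_congr (n := i.val + 1)]
    split_ifs at hnext <;> grind
  have hval₂ : affineLayers d k f (q, i - 1) =
      layerMap (i.val + 1) f.1 q + ((i - 1).val : ℚ) * layerMap (i.val + 1) f.2 q := by
    rw [affineLayers_apply, layerMap_congr (n := i.val + 1)]
    split_ifs at hprev <;> grind
  have hadj (w) := boxProd_adj_iff hk (u := (q, i)) (v := w)
  have hflip (hv' : v.2 ≠ i) :
      layerMap (i.val + 1) f.1 q + (i.val : ℚ) * layerMap (i.val + 1) f.2 q = 0 := by
    rw [Finset.sum_eq_zero fun j _ => by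
      rw [hzero (flip q j, i) (fun h => hv' (h ▸ rfl)) ((hadj _).2 (Or.inl ⟨j, rfl⟩)),
        mul_zero]] at hsum
    exact (mul_eq_zero.1 hsum.symm).resolve_left hc
  rcases (hadj v).1 hvu.symm with ⟨j, rfl⟩ | rfl | rfl
  · have h₁ := hzero (q, i + 1) (fun h => flip_ne q j (congrArg Prod.fst h).symm)
      ((hadj _).2 (by simp))
    have h₂ := hzero (q, i - 1) (fun h => flip_ne q j (congrArg Prod.fst h).symm)
      ((hadj _).2 (by simp))
    rw [hval₁] at h₁
    rw [hval₂] at h₂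
    obtain ⟨hx, hy⟩ := eq_zero_of_add_mul_eq_zero (Nat.cast_injective.ne hne) h₁ h₂
    rw [hx, hy, Finset.sum_eq_single j (fun l _ hl => by
      rw [hzero (flip q l, i) (fun h => hl (flip_injective q (congrArg Prod.fst h)))
        ((hadj _).2 (Or.inl ⟨l, rfl⟩)), mul_zero]) (fun h => absurd (Finset.mem_univ j) h)] at hsum
    simp only [mul_zero, add_zero] at hsum
    exact hv ((mul_eq_zero.1 hsum).resolve_left (edgeSign_ne_zero j q))
  · have h₁ := hflip fun h => hne₁ (congrArg (fun a : Fin (2 * k) => (a.val : ℚ)) h)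
    have h₂ := hzero (q, i - 1) (fun h => hne (congrArg (fun w => w.2.val) h).symm)
      ((hadj _).2 (by simp))
    rw [hval₂] at h₂
    obtain ⟨hx, hy⟩ := eq_zero_of_add_mul_eq_zero hne₂ h₂ h₁
    exact hv (by rw [hval₁, hx, hy, mul_zero, add_zero])
  · have h₁ := hflip fun h => hne₂ (congrArg (fun a : Fin (2 * k) => (a.val : ℚ)) h)
    have h₂ := hzero (q, i + 1) (fun h => hne (congrArg (fun w => w.2.val) h))
      ((hadj _).2 (by simp))
    rw [hval₁] at h₂
    obtain ⟨hx, hy⟩ := eq_zero_of_add_mul_eq_zero hne₁ h₂ h₁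
    exact hv (by rw [hval₂, hx, hy, mul_zero, add_zero])

theorem two_pow_le_ncard_of_forcing (hd : 1 ≤ d) (hk : 2 ≤ k)
    {M : (hypercube d □ cycleGraph (2 * k)).Subgraph} (hM : M.IsPerfectMatching)
    {S : Set (Sym2 ((Fin d → Bool) × Fin (2 * k)))} (hS : S ⊆ M.edgeSet)
    (hforce : ∀ M' : (hypercube d □ cycleGraph (2 * k)).Subgraph,
      M'.IsPerfectMatching → S ⊆ M'.edgeSet → M' = M) : 2 ^ d ≤ S.ncard := by
  have h := finrank_le_two_mul_ncard_of_forcing (fun v => decide (vertexParity v = 0))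
    (fun u v huv => by
      rw [vertexParity_of_adj hk huv]
      generalize vertexParity u = a
      revert a
      decide)
    (LinearMap.range (affineLayers d k))
    (by
      rintro _ ⟨f, rfl⟩
      exact affineLayers_exists_other_neighbor hd hk f) hM hS hforce
  rw [finrank_range_affineLayers hk] at h
  omega

/-- The partner of a vertex in the matching that joins each vertex of even parity to the next
vertex along the cycle. -/
def partner (v : (Fin d → Bool) × Fin (2 * k)) : (Fin d → Bool) × Fin (2 * k) :=
  if vertexParity v = 0 then (v.1, v.2 + 1) else (v.1, v.2 - 1)

theorem partner_adj (hk : 2 ≤ k) (v : (Fin d → Bool) × Fin (2 * k)) :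
    (hypercube d □ cycleGraph (2 * k)).Adj v (partner v) := by
  rw [boxProd_adj_iff hk, partner]
  split_ifs <;> simp

theorem partner_of_even {v : (Fin d → Bool) × Fin (2 * k)} (h : vertexParity v = 0) :
    partner v = (v.1, v.2 + 1) := if_pos h

theorem partner_involutive (hk : 2 ≤ k) : Function.Involutive (partner (d := d) (k := k)) := by
  intro v
  by_cases h : vertexParity v = 0
  · rw [partner_of_even h, partner, vertexParity_add_one (by omega), h, if_neg (by decide)]
    simp
  · have h' : vertexParity v + 1 = 0 := by
      revert h
      generalize vertexParity v = a
      revert a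
      decide
    rw [partner, partner, if_neg h, vertexParity_sub_one (by omega), if_pos h']
    simp

theorem involution_eq_partner_of_even (hk : 2 ≤ k)
    {p : (Fin d → Bool) × Fin (2 * k) → (Fin d → Bool) × Fin (2 * k)}
    (hp : Function.Injective p) (hadj : ∀ v, (hypercube d □ cycleGraph (2 * k)).Adj v (p v))
    (hstart : ∀ v, vertexParity v = 0 → v.2.val < 2 → p v = partner v)
    (v : (Fin d → Bool) × Fin (2 * k)) (hv : vertexParity v = 0) : p v = partner v := by
  induction hn : v.2.val using Nat.strong_induction_on generalizing v with
  | _ n ih =>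
    subst hn
    by_cases hlt : v.2.val < 2
    · exact hstart v hv hlt
    have h₁ : (v.2 - 1).val = v.2.val - 1 := by
      rw [val_sub_one_eq (by omega), if_neg (by omega)]
    have h₂ : (v.2 - 1 - 1).val = v.2.val - 2 := by
      rw [val_sub_one_eq (by omega), if_neg (by omega), h₁]
      omega
    rcases (boxProd_adj_iff hk).1 (hadj v) with ⟨j, h⟩ | h | h
    · have heven : vertexParity (flip v.1 j, v.2 - 1) = 0 := by
        have := vertexParity_sub_one (by omega) (flip v.1 j, v.2)
        rw [this, vertexParity_flip, hv]
        rfl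
      have hq := ih _ (by simp only [h₁]; omega) _ heven rfl
      rw [partner_of_even heven, sub_add_cancel, ← h] at hq
      exact absurd (congrArg Prod.fst (hp hq)) (flip_ne v.1 j)
    · rw [h, partner_of_even hv]
    · have heven : vertexParity (v.1, v.2 - 1 - 1) = 0 := by
        have := vertexParity_sub_one (by omega) (v.1, v.2 - 1)
        rw [this, vertexParity_sub_one (by omega), hv]
        rfl
      have hq := ih _ (by simp only [h₂]; omega) _ heven rfl
      rw [partner_of_even heven, sub_add_cancel, ← h] at hq
      have := congrArg (fun w => w.2.val) (hp hq)
      simp only [h₂] at this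
      omega

/-- The vertex of even parity above `q` at position zero or one of the cycle. -/
def startVertex (k : ℕ) [NeZero (2 * k)] (q : Fin d → Bool) : (Fin d → Bool) × Fin (2 * k) :=
  (q, if parity q = 0 then 0 else 1)

theorem eq_startVertex {v : (Fin d → Bool) × Fin (2 * k)} (hv : vertexParity v = 0)
    (hlt : v.2.val < 2) : v = startVertex k v.1 := by
  obtain ⟨q, i⟩ := v
  have hpar : parity q = 0 ↔ i.val = 0 := by
    simp only [vertexParity] at hv hlt
    obtain h | h : i.val = 0 ∨ i.val = 1 := by omega
    · simpa [h] using hv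
    · rw [h] at hv ⊢
      revert hv
      generalize parity q = a
      revert a
      decide
  refine Prod.ext rfl (Fin.ext ?_)
  simp only [startVertex, hpar]
  split_ifs with h
  · simpa using h
  · have hi := i.isLt
    simp only at hlt
    rw [Fin.val_one', Nat.mod_eq_of_lt (by omega)]
    omega

theorem exists_forcing_ncard_le (hk : 2 ≤ k) :
    ∃ M : (hypercube d □ cycleGraph (2 * k)).Subgraph, M.IsPerfectMatching ∧
      ∃ S ⊆ M.edgeSet, S.ncard ≤ 2 ^ d ∧
        ∀ M' : (hypercube d □ cycleGraph (2 * k)).Subgraph,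
          M'.IsPerfectMatching → S ⊆ M'.edgeSet → M' = M := by
  have hM := involutionSubgraph_isPerfectMatching partner (partner_involutive (d := d) hk)
    (partner_adj hk)
  refine ⟨_, hM,
    Set.range fun q : Fin d → Bool => s(startVertex k q, partner (startVertex k q)), ?_, ?_,
    fun M' hM' hS => eq_of_isPerfectMatching_of_adj hM hM' ?_⟩
  · rintro _ ⟨q, rfl⟩
    exact rfl
  · rw [← Set.image_univ]
    refine (Set.ncard_image_le Set.finite_univ).trans ?_
    simp [Set.ncard_univ]
  · obtain ⟨p, hp, hMp⟩ := exists_involution_of_isPerfectMatching hM'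
    have heq := involution_eq_partner_of_even hk hp.injective
      (fun v => M'.adj_sub ((hMp _ _).2 rfl)) fun v hv hlt => by
        rw [eq_startVertex hv hlt]
        exact (hMp _ _).1 (hS ⟨v.1, rfl⟩)
    rintro v _ rfl
    by_cases hv : vertexParity v = 0
    · exact (hMp _ _).2 (heq v hv)
    · refine M'.symm.symm _ _ ((hMp _ _).2 ?_)
      rw [heq, partner_involutive hk]
      rw [vertexParity_of_adj hk (partner_adj hk v)]
      revert hv
      generalize vertexParity v = a
      revert a
      decide

end Product

end HypercubeCycle

theorem stmt11 (d : ℕ) (hd : 1 ≤ d) (k : ℕ) (hk : 2 ≤ k) :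
    minForcingNumber (hypercube d □ cycleGraph (2 * k)) = 2 ^ d := by
  have : NeZero (2 * k) := ⟨by omega⟩
  exact HypercubeCycle.minForcingNumber_eq
    (fun _ hM _ hS hforce => HypercubeCycle.two_pow_le_ncard_of_forcing hd hk hM hS hforce)
    (HypercubeCycle.exists_forcing_ncard_le hk)
end

section
/- For every odd integer d ≥ 1 and every integer k ≥ 2, the minimum forcing number of the Cartesian product of the folded d-dimensional hypercube with the cycle on 2k vertices satisfies f(FQ_d □ C_{2k}) = 2^d. -/
open SimpleGraph

def foldedHypercube (d : ℕ) : SimpleGraph (Fin d → Bool) :=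
  SimpleGraph.fromRel (fun u v =>
    (Finset.univ.filter (fun i => u i ≠ v i)).card = 1 ∨ ∀ i, u i ≠ v i)

section PerfectMatching

variable {V : Type*} {G : SimpleGraph V}

/-- The spanning subgraph joining each vertex to its image under an involution. -/
def involutionMatching (p : V → V) (hadj : ∀ v, G.Adj v (p v)) (hp : Function.Involutive p) :
    G.Subgraph where
  verts := Set.univ
  Adj u v := p u = v
  adj_sub := by
    rintro u v rfl
    exact hadj u
  edge_vert := fun _ => Set.mem_univ _
  symm := ⟨by
    rintro u v rfl
    exact hp u⟩

theorem involutionMatching_isPerfectMatching (p : V → V) (hadj : ∀ v, G.Adj v (p v))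
    (hp : Function.Involutive p) : (involutionMatching p hadj hp).IsPerfectMatching := by
  rw [Subgraph.isPerfectMatching_iff]
  exact fun v => ⟨p v, rfl, fun w hw => Eq.symm hw⟩

theorem SimpleGraph.Subgraph.IsPerfectMatching.adj_unique {M : G.Subgraph}
    (hM : M.IsPerfectMatching) {u v w : V} (hv : M.Adj u v) (hw : M.Adj u w) : v = w :=
  (Subgraph.isPerfectMatching_iff.1 hM u).unique hv hw

theorem SimpleGraph.Subgraph.IsPerfectMatching.eq_of_adj_imp {M M' : G.Subgraph}
    (hM : M.IsPerfectMatching) (hM' : M'.IsPerfectMatching)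
    (h : ∀ u v, M.Adj u v → M'.Adj u v) : M' = M := by
  refine Subgraph.ext ?_ ?_
  · rw [Subgraph.isSpanning_iff.1 hM.2, Subgraph.isSpanning_iff.1 hM'.2]
  · ext u v
    refine ⟨fun huv => ?_, h u v⟩
    obtain ⟨w, hw, -⟩ := Subgraph.isPerfectMatching_iff.1 hM u
    rwa [hM'.adj_unique huv (h u w hw)]

theorem SimpleGraph.Subgraph.IsPerfectMatching.exists_involutive {M : G.Subgraph}
    (hM : M.IsPerfectMatching) :
    ∃ p : V → V, Function.Involutive p ∧ ∀ u v, M.Adj u v ↔ p u = v := by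
  choose p hp hp' using Subgraph.isPerfectMatching_iff.1 hM
  exact ⟨p, fun v => (hp' _ _ (hp v).symm).symm,
    fun u v => ⟨fun h => (hp' _ _ h).symm, by rintro rfl; exact hp u⟩⟩

/-- A lower bound on the size of all forcing sets bounds the minimum forcing number from below. -/
theorem le_minForcingNumber {c : ℕ} (hG : ∃ M : G.Subgraph, M.IsPerfectMatching)
    (h : ∀ M : G.Subgraph, M.IsPerfectMatching → ∀ S ⊆ M.edgeSet,
      (∀ M' : G.Subgraph, M'.IsPerfectMatching → S ⊆ M'.edgeSet → M' = M) → c ≤ S.ncard) :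
    c ≤ minForcingNumber G := by
  obtain ⟨M₀, hM₀⟩ := hG
  refine le_csInf ⟨_, M₀, hM₀, rfl⟩ ?_
  rintro _ ⟨M, hM, rfl⟩
  refine le_csInf ⟨_, M.edgeSet, subset_rfl, rfl, fun M' hM' hS => ?_⟩ ?_
  · exact hM.eq_of_adj_imp hM' fun u v huv => Subgraph.mem_edgeSet.1 (hS huv)
  · rintro _ ⟨S, hS, rfl, hforce⟩
    exact h M hM S hS hforce

theorem minForcingNumber_le {M : G.Subgraph} (hM : M.IsPerfectMatching) {S : Set (Sym2 V)}
    (hS : S ⊆ M.edgeSet)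
    (hforce : ∀ M' : G.Subgraph, M'.IsPerfectMatching → S ⊆ M'.edgeSet → M' = M) :
    minForcingNumber G ≤ S.ncard :=
  le_trans (b := forcingNumber G M) (Nat.sInf_le ⟨M, hM, rfl⟩)
    (Nat.sInf_le ⟨S, hS, rfl, hforce⟩)

end PerfectMatching

section Kernel

variable {V : Type*} {G : SimpleGraph V}

theorem eq_one_of_forcing {col : V → ZMod 2} (hcol : ∀ u v, G.Adj u v → col v = col u + 1)
    {M : G.Subgraph} {p : V → V} (hp : Function.Involutive p)
    (hMp : ∀ u v, M.Adj u v ↔ p u = v) {S : Set (Sym2 V)} (hS : S ⊆ M.edgeSet)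
    (hforce : ∀ M' : G.Subgraph, M'.IsPerfectMatching → S ⊆ M'.edgeSet → M' = M)
    {c : ZMod 2} (σ : Equiv.Perm V) (hσc : ∀ u, col (σ u) = col u)
    (hσS : ∀ u, s(u, p u) ∈ S → σ u = u) (hσ : ∀ u, col u = c → G.Adj u (p (σ u)))
    (u : V) (hu : col u = c) : σ u = u := by
  classical
  have hpadj : ∀ v, G.Adj v (p v) := fun v => M.adj_sub ((hMp v _).2 rfl)
  have hpc : ∀ v, col (p v) = col v + 1 := fun v => hcol _ _ (hpadj v)
  have two : ∀ a b : ZMod 2, a ≠ b ↔ a + 1 = b := by decide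
  have one_ne : ∀ a : ZMod 2, a + 1 ≠ a := by decide
  have hσc' : ∀ u, col (σ.symm u) = col u := fun u => by
    rw [← hσc (σ.symm u), Equiv.apply_symm_apply]
  let q : V → V := fun v => if col v = c then p (σ v) else σ.symm (p v)
  have hq : Function.Involutive q := by
    intro v
    by_cases hv : col v = c
    · have : col (p (σ v)) ≠ c := by rw [hpc, hσc, hv]; exact one_ne c
      simp [q, hv, this, hp (σ v)]
    · have : col (σ.symm (p v)) = c := by rw [hσc', hpc]; exact (two _ _).1 hv
      simp [q, hv, this, hp v]
  have hqadj : ∀ v, G.Adj v (q v) := by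
    intro v
    by_cases hv : col v = c
    · simpa [q, hv] using hσ v hv
    · have : col (σ.symm (p v)) = c := by rw [hσc', hpc]; exact (two _ _).1 hv
      have h := hσ _ this
      rw [Equiv.apply_symm_apply, hp v] at h
      simpa [q, hv] using h.symm
  have key : involutionMatching q hqadj hq = M := by
    refine hforce _ (involutionMatching_isPerfectMatching q hqadj hq) fun e he => ?_
    induction e with
    | h a b =>
      have hab : p a = b := (hMp a b).1 (hS he)
      subst hab
      change q a = p a
      by_cases ha : col a = c
      · simp [q, ha, hσS a he]
      · have : σ (p a) = p a := hσS _ (by rwa [hp a, Sym2.eq_swap])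
        simp only [q, ha, if_false]
        rw [Equiv.symm_apply_eq, this]
  have hadj : M.Adj u (p (σ u)) := by
    rw [← key]
    change q u = _
    simp [q, hu]
  exact (hp.injective ((hMp _ _).1 hadj)).symm

variable {K : Type*} [Fintype V] [Field K]

theorem kernel_eq_zero_of_forcing {col : V → ZMod 2}
    (hcol : ∀ u v, G.Adj u v → col v = col u + 1)
    {wt : V → V → K} (hwt : ∀ u v, wt u v ≠ 0 ↔ G.Adj u v)
    {M : G.Subgraph} {p : V → V} (hp : Function.Involutive p)
    (hMp : ∀ u v, M.Adj u v ↔ p u = v) {S : Set (Sym2 V)} (hS : S ⊆ M.edgeSet)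
    (hforce : ∀ M' : G.Subgraph, M'.IsPerfectMatching → S ⊆ M'.edgeSet → M' = M)
    {x : V → K} (hker : ∀ u, ∑ v, wt u v * x v = 0) (hx : ∀ v, s(v, p v) ∈ S → x v = 0) :
    x = 0 := by
  classical
  have hpadj : ∀ v, G.Adj v (p v) := fun v => M.adj_sub ((hMp v _).2 rfl)
  suffices h : ∀ u, x (p u) = 0 by
    funext v
    simpa [hp v] using h (p v)
  intro u₀
  by_cases hu₀ : s(u₀, p u₀) ∈ S
  · exact hx _ (by rwa [hp u₀, Sym2.eq_swap])
  let P : V → Prop := fun u => col u = col u₀ ∧ s(u, p u) ∉ S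
  let N : Matrix {u // P u} {u // P u} K := fun u' u => wt u (p u')
  have hdet : N.det ≠ 0 := by
    rw [Matrix.det_apply, Finset.sum_eq_single 1]
    · simp only [Equiv.Perm.sign_one, one_smul, Equiv.Perm.one_apply]
      exact Finset.prod_ne_zero_iff.2 fun u _ => (hwt _ _).2 (hpadj u)
    · intro σ _ hσ
      by_contra hne
      have hprod : ∏ i, N (σ i) i ≠ 0 := fun h0 => hne (by rw [h0, smul_zero])
      have hN : ∀ i : {u // P u}, G.Adj i (p (σ i)) := fun i =>
        (hwt _ _).1 (Finset.prod_ne_zero_iff.1 hprod i (Finset.mem_univ _))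
      refine hσ (Equiv.ext fun i => Subtype.ext ?_)
      have hfix := eq_one_of_forcing hcol hp hMp hS hforce (c := col u₀)
        (Equiv.Perm.ofSubtype σ) ?_ ?_ ?_ i i.2.1
      · rwa [Equiv.Perm.ofSubtype_apply_coe] at hfix
      · intro u
        by_cases hu : P u
        · rw [Equiv.Perm.ofSubtype_apply_of_mem σ hu, (σ ⟨u, hu⟩).2.1, hu.1]
        · rw [Equiv.Perm.ofSubtype_apply_of_not_mem σ hu]
      · exact fun u hu => Equiv.Perm.ofSubtype_apply_of_not_mem σ fun h => h.2 hu
      · intro u hu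
        by_cases hPu : P u
        · rw [Equiv.Perm.ofSubtype_apply_of_mem σ hPu]
          exact hN ⟨u, hPu⟩
        · rw [Equiv.Perm.ofSubtype_apply_of_not_mem σ hPu]
          exact hpadj u
    · exact fun h => absurd (Finset.mem_univ _) h
  have hvec : Matrix.vecMul (fun u : {u // P u} => x (p u)) N = 0 := by
    funext u
    have h := hker u
    rw [← Equiv.sum_comp hp.toPerm] at h
    simp only [Matrix.vecMul, dotProduct, Pi.zero_apply, N]
    rw [← h]
    have hzero : ∑ v ∈ Finset.univ.filter P, wt u (p v) * x (p v)
        = ∑ v, wt u (p v) * x (p v) := by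
      refine Finset.sum_subset (Finset.subset_univ _) fun v _ hv => ?_
      by_contra hne
      have hadj := (hwt _ _).1 (left_ne_zero_of_mul hne)
      have h1 := hcol _ _ hadj
      rw [hcol _ _ (hpadj v)] at h1
      refine hv (Finset.mem_filter.2 ⟨Finset.mem_univ _, ?_, fun hvS => ?_⟩)
      · rw [add_right_cancel h1, u.2.1]
      · exact right_ne_zero_of_mul hne (hx _ (by rwa [hp v, Sym2.eq_swap]))
    calc ∑ v : {u // P u}, x (p v) * wt u (p v)
        = ∑ v : {u // P u}, wt u (p v) * x (p v) := by simp only [mul_comm]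
      _ = ∑ v ∈ Finset.univ.filter P, wt u (p v) * x (p v) :=
          (Finset.sum_subtype _ (by simp) fun v => wt u (p v) * x (p v)).symm
      _ = _ := hzero
  exact congrFun (Matrix.eq_zero_of_vecMul_eq_zero hdet hvec) ⟨u₀, rfl, hu₀⟩

/-- The nullity of a weighted adjacency matrix of a bipartite graph is at most twice the size of
any forcing set. -/
theorem finrank_le_of_forcing {col : V → ZMod 2}
    (hcol : ∀ u v, G.Adj u v → col v = col u + 1)
    {wt : V → V → K} (hwt : ∀ u v, wt u v ≠ 0 ↔ G.Adj u v)
    {M : G.Subgraph} (hM : M.IsPerfectMatching) {S : Set (Sym2 V)} (hS : S ⊆ M.edgeSet)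
    (hforce : ∀ M' : G.Subgraph, M'.IsPerfectMatching → S ⊆ M'.edgeSet → M' = M)
    {E : Type*} [AddCommGroup E] [Module K E] (Φ : E →ₗ[K] V → K)
    (hΦ : Function.Injective Φ) (hker : ∀ e u, ∑ v, wt u v * Φ e v = 0) :
    Module.finrank K E ≤ 2 * S.ncard := by
  classical
  obtain ⟨p, hp, hMp⟩ := hM.exists_involutive
  let T := {v // s(v, p v) ∈ S}
  let Ψ : E →ₗ[K] T → K := (LinearMap.funLeft K K (Subtype.val : T → V)).comp Φ
  have hΨ : Function.Injective Ψ := by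
    rw [injective_iff_map_eq_zero]
    intro e he
    refine (injective_iff_map_eq_zero Φ).1 hΦ e ?_
    exact kernel_eq_zero_of_forcing hcol hwt hp hMp hS hforce (hker e)
      fun v hv => congrFun he (⟨v, hv⟩ : T)
  have hdim := LinearMap.finrank_le_finrank_of_injective hΨ
  rw [Module.finrank_fintype_fun_eq_card] at hdim
  refine hdim.trans ?_
  let g : T → ZMod 2 × S := fun v => (col v, ⟨s(v, p v), v.2⟩)
  have hg : Function.Injective g := by
    rintro ⟨u, hu⟩ ⟨v, hv⟩ huv
    simp only [g, Prod.mk.injEq, Subtype.mk.injEq, Sym2.eq_iff] at huv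
    rcases huv.2 with h | h
    · exact Subtype.ext h.1
    · have := hcol _ _ (M.adj_sub ((hMp v _).2 rfl))
      rw [← h.1, huv.1] at this
      exact absurd this.symm (by generalize col v = a; revert a; decide)
  have hcard := Fintype.card_le_of_injective g hg
  rwa [Fintype.card_prod, ZMod.card, ← Nat.card_eq_fintype_card (α := S),
    Nat.card_coe_set_eq] at hcard

end Kernel

section Cycle

variable {j : ℕ}

theorem cast_val_add_one (hj : Even j) (i : Fin (j + 4)) :
    (((i + 1 : Fin (j + 4)) : ℕ) : ZMod 2) = ((i : ℕ) : ZMod 2) + 1 := by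
  rw [Fin.val_add_one]
  split_ifs with h
  · subst h
    obtain ⟨a, rfl⟩ := hj
    simp only [Fin.val_last]
    push_cast
    generalize (a : ZMod 2) = b
    revert b
    decide
  · push_cast
    rfl

theorem cast_val_sub_one (hj : Even j) (i : Fin (j + 4)) :
    (((i - 1 : Fin (j + 4)) : ℕ) : ZMod 2) = ((i : ℕ) : ZMod 2) + 1 := by
  have h := cast_val_add_one hj (i - 1)
  rw [sub_add_cancel] at h
  rw [h, add_assoc, CharTwo.add_self_eq_zero, add_zero]

theorem fin_add_one_ne_sub_one (i : Fin (j + 4)) : i + 1 ≠ i - 1 := by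
  intro h
  have h2 : (1 : Fin (j + 4)) + 1 = 0 := by
    have := congrArg (fun a => a + 1 - i) h
    simpa [add_assoc, add_comm, add_left_comm] using this
  have := congrArg Fin.val h2
  simp [Fin.val_add, Nat.mod_eq_of_lt (show 2 < j + 4 by omega)] at this

theorem fin_add_one_ne (i : Fin (j + 4)) : i + 1 ≠ i := by simp

theorem fin_sub_one_ne (i : Fin (j + 4)) : i - 1 ≠ i := by simp

theorem cycleGraph_adj_iff (i i' : Fin (j + 4)) :
    (cycleGraph (j + 4)).Adj i i' ↔ i' = i + 1 ∨ i' = i - 1 := by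
  rw [cycleGraph_adj]
  constructor
  · rintro (h | h)
    · right; rw [← h]; abel
    · left; rw [← h]; abel
  · rintro (rfl | rfl)
    · right; abel
    · left; abel

variable {H : Type*} {G : SimpleGraph H} {col : H → ZMod 2}

theorem boxProd_cycle_col (hcol : ∀ u v, G.Adj u v → col v = col u + 1) (hj : Even j)
    (u v : H × Fin (j + 4)) (h : (G □ cycleGraph (j + 4)).Adj u v) :
    col v.1 + ((v.2 : ℕ) : ZMod 2) = col u.1 + ((u.2 : ℕ) : ZMod 2) + 1 := by
  rw [boxProd_adj, cycleGraph_adj_iff] at h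
  rcases h with ⟨h, h'⟩ | ⟨h | h, h'⟩
  · rw [hcol _ _ h, h']; ring
  · rw [h, h', cast_val_add_one hj]; ring
  · rw [h, h', cast_val_sub_one hj]; ring

/-- In `G □ C`, match each vertex of colour `0` with its successor along the cycle. -/
def staggered (col : H → ZMod 2) (v : H × Fin (j + 4)) : H × Fin (j + 4) :=
  (v.1, if col v.1 + ((v.2 : ℕ) : ZMod 2) = 0 then v.2 + 1 else v.2 - 1)

theorem staggered_involutive (hj : Even j) :
    Function.Involutive (staggered (j := j) col) := by
  rintro ⟨h, i⟩
  have two : ∀ a b : ZMod 2, a + (b + 1) = 0 ↔ a + b ≠ 0 := by decide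
  by_cases hc : col h + ((i : ℕ) : ZMod 2) = 0
  · simp [staggered, hc, cast_val_add_one hj, two]
  · simp [staggered, hc, cast_val_sub_one hj, two]

theorem staggered_adj (v : H × Fin (j + 4)) :
    (G □ cycleGraph (j + 4)).Adj v (staggered col v) := by
  rw [boxProd_adj, cycleGraph_adj_iff]
  right
  simp only [staggered, and_true]
  split_ifs <;> simp

theorem staggered_forced (hcol : ∀ u v, G.Adj u v → col v = col u + 1) (hj : Even j)
    {M : (G □ cycleGraph (j + 4)).Subgraph} (hM : M.IsPerfectMatching)
    (h0 : ∀ h, M.Adj (h, 0) (staggered col (h, 0))) (i : Fin (j + 4)) :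
    ∀ h, M.Adj (h, i) (staggered col (h, i)) := by
  have two : ∀ a b : ZMod 2, a + (b + 1) = 0 ↔ a + b ≠ 0 := by decide
  induction i using Fin.induction with
  | zero => exact h0
  | succ i ih =>
    rw [← Fin.coeSucc_eq_succ]
    generalize i.castSucc = i at ih
    have hblack : ∀ h, col h + (((i + 1 : Fin (j + 4)) : ℕ) : ZMod 2) ≠ 0 →
        M.Adj (h, i + 1) (h, i) := by
      intro h hc
      rw [cast_val_add_one hj, Ne, two, not_not] at hc
      have := ih h
      simp only [staggered, hc, if_true] at this
      exact this.symm
    intro h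
    by_cases hc : col h + (((i + 1 : Fin (j + 4)) : ℕ) : ZMod 2) = 0
    · obtain ⟨⟨h', i'⟩, hv, -⟩ := Subgraph.isPerfectMatching_iff.1 hM (h, i + 1)
      have hadj := M.adj_sub hv
      have hcv := boxProd_cycle_col hcol hj _ _ hadj
      rw [boxProd_adj, cycleGraph_adj_iff] at hadj
      simp only [staggered, hc, if_true]
      simp only at hadj hcv
      rw [hc] at hcv
      rcases hadj with ⟨-, rfl⟩ | ⟨rfl | rfl, rfl⟩
      · have := hM.adj_unique hv.symm (hblack h' (by rw [hcv]; decide))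
        exact absurd (congrArg Prod.snd this) (fin_add_one_ne i)
      · exact hv
      · rw [add_sub_cancel_right] at hv hcv
        have h1 := ih h
        simp only [staggered, hcv] at h1
        have := hM.adj_unique hv.symm h1
        exact absurd (congrArg Prod.snd this) (by simpa using fin_add_one_ne_sub_one i)
    · simpa [staggered, hc] using hblack h hc

theorem minForcingNumber_boxProd_cycle_le [Fintype H]
    (hcol : ∀ u v, G.Adj u v → col v = col u + 1) (hj : Even j) :
    minForcingNumber (G □ cycleGraph (j + 4)) ≤ Fintype.card H := by
  have hpm := involutionMatching_isPerfectMatching _ (staggered_adj (G := G) (col := col))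
    (staggered_involutive hj)
  refine (minForcingNumber_le hpm
    (S := Set.range fun h : H => s((h, (0 : Fin (j + 4))), staggered col (h, 0)))
    ?_ ?_).trans ?_
  · rintro _ ⟨h, rfl⟩
    exact rfl
  · refine fun M' hM' hS => hpm.eq_of_adj_imp hM' ?_
    rintro ⟨h, i⟩ _ rfl
    exact staggered_forced hcol hj hM'
      (fun h => Subgraph.mem_edgeSet.1 (hS ⟨h, rfl⟩)) i h
  · rw [← Set.image_univ]
    refine (Set.ncard_image_le Set.finite_univ).trans ?_
    rw [Set.ncard_univ, Nat.card_eq_fintype_card]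

variable {K : Type*} [Field K]

/-- A weighted adjacency matrix of `G □ C` of large nullity, built from one of `G`. -/
def cycleWeight [DecidableEq H] (W : Matrix H H K) (t : Fin (j + 4) → K)
    (u v : H × Fin (j + 4)) : K :=
  (if v.2 = u.2 then (t (u.2 - 1) - t (u.2 + 1)) * W u.1 v.1 else 0) +
    ((if v = (u.1, u.2 + 1) then t u.2 - t (u.2 - 1) else 0) +
      (if v = (u.1, u.2 - 1) then t (u.2 + 1) - t u.2 else 0))

theorem cycleWeight_ne_zero_iff [DecidableEq H] {W : Matrix H H K}
    (hW : ∀ u v, W u v ≠ 0 ↔ G.Adj u v) {t : Fin (j + 4) → K} (ht : Function.Injective t)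
    (u v : H × Fin (j + 4)) :
    cycleWeight W t u v ≠ 0 ↔ (G □ cycleGraph (j + 4)).Adj u v := by
  obtain ⟨h, i⟩ := u
  obtain ⟨h', i'⟩ := v
  rw [boxProd_adj, cycleGraph_adj_iff, ← hW]
  have e1 : t (i - 1) - t (i + 1) ≠ 0 :=
    sub_ne_zero.2 (ht.ne (fin_add_one_ne_sub_one i).symm)
  have e2 : t i - t (i - 1) ≠ 0 := sub_ne_zero.2 (ht.ne (fin_sub_one_ne i).symm)
  have e3 : t (i + 1) - t i ≠ 0 := sub_ne_zero.2 (ht.ne (fin_add_one_ne i))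
  simp only [cycleWeight, Prod.mk.injEq]
  by_cases h1 : i' = i
  · subst h1
    simp [(fin_add_one_ne i').symm, (fin_sub_one_ne i').symm, -left_eq_add, -right_eq_add, e1]
  by_cases h2 : i' = i + 1
  · subst h2
    simp [fin_add_one_ne_sub_one i, e2, eq_comm (a := h')]
  by_cases h3 : i' = i - 1
  · subst h3
    simp [(fin_add_one_ne_sub_one i).symm, (fin_sub_one_ne i).symm, e3, eq_comm (a := h')]
  · simp [h1, h2, h3, Ne.symm h1]

theorem sum_cycleWeight_mul [Fintype H] [DecidableEq H] (W : Matrix H H K)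
    (t : Fin (j + 4) → K) (x : H × Fin (j + 4) → K) (h : H) (i : Fin (j + 4)) :
    ∑ v, cycleWeight W t (h, i) v * x v =
      (t (i - 1) - t (i + 1)) * W.mulVec (fun h' => x (h', i)) h +
        ((t i - t (i - 1)) * x (h, i + 1) + (t (i + 1) - t i) * x (h, i - 1)) := by
  simp only [cycleWeight, add_mul, Finset.sum_add_distrib, ite_mul, zero_mul,
    Finset.sum_ite_eq', Finset.mem_univ, if_true]
  congr 1
  rw [Fintype.sum_prod_type]
  simp only [Finset.sum_ite_eq', Finset.mem_univ, if_true, Matrix.mulVec, dotProduct,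
    Finset.mul_sum, mul_assoc]

/-- The kernel of `cycleWeight W t`, parametrised by pairs of functions on `H`. -/
def cycleKernel [Fintype H] (W : Matrix H H K) (t : Fin (j + 4) → K) :
    ((H → K) × (H → K)) →ₗ[K] H × Fin (j + 4) → K where
  toFun e v := if ((v.2 : ℕ) : ZMod 2) = 0 then (e.1 + t v.2 • e.2) v.1
    else W.mulVec (e.1 + t v.2 • e.2) v.1
  map_add' e f := by
    funext v
    simp only [Prod.fst_add, Prod.snd_add, smul_add, Matrix.mulVec_add, Pi.add_apply]
    split_ifs <;> ring
  map_smul' a e := by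
    funext v
    simp only [Prod.smul_fst, Prod.smul_snd, Matrix.mulVec_add, Matrix.mulVec_smul,
      Pi.add_apply, Pi.smul_apply, smul_eq_mul, RingHom.id_apply]
    split_ifs <;> ring

theorem cycleKernel_injective [Fintype H] (W : Matrix H H K) {t : Fin (j + 4) → K}
    (ht : Function.Injective t) : Function.Injective (cycleKernel W t) := by
  rw [injective_iff_map_eq_zero]
  rintro ⟨a, b⟩ he
  have h2 : ((2 : Fin (j + 4)) : ℕ) = 2 := rfl
  have hne : t 2 - t 0 ≠ 0 := sub_ne_zero.2 (ht.ne fun h => by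
    simpa [Nat.mod_eq_of_lt (show 2 < j + 4 by omega)] using congrArg Fin.val h)
  have key : ∀ h, a h = 0 ∧ b h = 0 := by
    intro h
    have e0 := congrFun he (h, 0)
    have e2 := congrFun he (h, 2)
    have z2 : ((2 : ℕ) : ZMod 2) = 0 := rfl
    simp [cycleKernel] at e0
    simp only [cycleKernel, LinearMap.coe_mk, AddHom.coe_mk, h2, z2, if_true, Pi.add_apply,
      Pi.smul_apply, smul_eq_mul, Pi.zero_apply] at e2
    have hb : b h = 0 := by
      have : (t 2 - t 0) * b h = 0 := by linear_combination e2 - e0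
      exact (mul_eq_zero.1 this).resolve_left hne
    refine ⟨by simpa [hb] using e0, hb⟩
  exact Prod.ext (funext fun h => (key h).1) (funext fun h => (key h).2)

theorem cycleWeight_mul_cycleKernel [Fintype H] [DecidableEq H] (hj : Even j)
    {W : Matrix H H K} (hW : W * W = 1) (t : Fin (j + 4) → K) (e : (H → K) × (H → K))
    (u : H × Fin (j + 4)) : ∑ v, cycleWeight W t u v * cycleKernel W t e v = 0 := by
  obtain ⟨h, i⟩ := u
  obtain ⟨a, b⟩ := e
  have two : ∀ c : ZMod 2, c + 1 = 0 ↔ c ≠ 0 := by decide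
  rw [sum_cycleWeight_mul]
  simp only [cycleKernel, LinearMap.coe_mk, AddHom.coe_mk, cast_val_add_one hj,
    cast_val_sub_one hj, two]
  by_cases hi : ((i : ℕ) : ZMod 2) = 0
  · simp only [hi, if_true, ne_eq, not_true_eq_false, if_false]
    change _ * W.mulVec (a + t i • b) h + _ = 0
    simp only [Matrix.mulVec_add, Matrix.mulVec_smul, Pi.add_apply, Pi.smul_apply, smul_eq_mul]
    ring
  · simp only [hi, if_false, ne_eq, not_false_eq_true, if_true]
    change _ * W.mulVec (W.mulVec (a + t i • b)) h + _ = 0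
    rw [Matrix.mulVec_mulVec, hW, Matrix.one_mulVec]
    simp only [Pi.add_apply, Pi.smul_apply, smul_eq_mul]
    ring

/-- If a bipartite graph `G` has a weighted adjacency matrix squaring to `1` over an infinite
field, then the minimum forcing number of its product with an even cycle is the order of `G`. -/
theorem minForcingNumber_boxProd_cycle [Fintype H] [DecidableEq H] [Infinite K]
    (hcol : ∀ u v, G.Adj u v → col v = col u + 1) (hj : Even j) {W : Matrix H H K}
    (hW : ∀ u v, W u v ≠ 0 ↔ G.Adj u v) (hWW : W * W = 1) :
    minForcingNumber (G □ cycleGraph (j + 4)) = Fintype.card H := by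
  refine le_antisymm (minForcingNumber_boxProd_cycle_le hcol hj) (le_minForcingNumber
    ⟨_, involutionMatching_isPerfectMatching _ (staggered_adj (col := col))
      (staggered_involutive hj)⟩ fun M hM S hS hforce => ?_)
  let t : Fin (j + 4) → K := fun i => Infinite.natEmbedding K i
  have ht : Function.Injective t :=
    (Infinite.natEmbedding K).injective.comp Fin.val_injective
  have h := finrank_le_of_forcing (boxProd_cycle_col hcol hj) (cycleWeight_ne_zero_iff hW ht)
    hM hS hforce (cycleKernel W t) (cycleKernel_injective W ht)
    (cycleWeight_mul_cycleKernel hj hWW t)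
  rw [Module.finrank_prod, Module.finrank_fintype_fun_eq_card] at h
  omega

end Cycle

section FoldedHypercube

variable {d : ℕ}

/-- Coordinatewise sum modulo two. -/
def bxor (u v : Fin d → Bool) : Fin d → Bool := fun i => xor (u i) (v i)

theorem bxor_bxor_cancel (u v : Fin d → Bool) : bxor u (bxor u v) = v := by
  funext i
  simp [bxor]

theorem bxor_comm (u v : Fin d → Bool) : bxor u v = bxor v u := by
  funext i
  simp [bxor, Bool.xor_comm]

/-- The unit vector in direction `i`. -/
def bsingle (i : Fin d) : Fin d → Bool := fun l => decide (l = i)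

theorem bsingle_injective : Function.Injective (bsingle (d := d)) := by
  intro i l h
  simpa [bsingle] using congrFun h i

theorem foldedHypercube_adj_iff (hd : d ≠ 0) (u v : Fin d → Bool) :
    (foldedHypercube d).Adj u v ↔ (∃ i, bxor u v = bsingle i) ∨ bxor u v = fun _ => true := by
  have h1 : ∀ u v : Fin d → Bool, (Finset.univ.filter (fun i => u i ≠ v i)).card = 1 ↔
      ∃ i, bxor u v = bsingle i := by
    intro u v
    rw [Finset.card_eq_one]
    refine exists_congr fun i => ?_
    rw [Finset.ext_iff, funext_iff]
    refine forall_congr' fun l => ?_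
    rw [Bool.eq_iff_iff]
    simp [bxor, bsingle]
  have h2 : ∀ u v : Fin d → Bool, (∀ i, u i ≠ v i) ↔ bxor u v = fun _ => true := by
    intro u v
    rw [funext_iff]
    simp [bxor]
  rw [foldedHypercube, fromRel_adj, h1, h1, h2, h2, bxor_comm v u, or_self, and_iff_right_iff_imp]
  rintro h rfl
  have h0 : ∀ i, bxor u u i = false := fun i => by simp [bxor]
  rcases h with ⟨i, h⟩ | h
  · have := congrFun h i
    simp [h0, bsingle] at this
  · have := congrFun h ⟨0, Nat.pos_of_ne_zero hd⟩
    simp [h0] at this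

/-- The parity of the number of `true` coordinates. -/
def parity (u : Fin d → Bool) : ZMod 2 := ∑ i, if u i then 1 else 0

theorem parity_bxor (u v : Fin d → Bool) : parity v = parity u + parity (bxor u v) := by
  simp only [parity, ← Finset.sum_add_distrib]
  refine Finset.sum_congr rfl fun i _ => ?_
  cases hu : u i <;> cases hv : v i <;> simp [bxor, hu, hv]
  rfl

theorem parity_of_adj (hd : Odd d) (u v : Fin d → Bool) (h : (foldedHypercube d).Adj u v) :
    parity v = parity u + 1 := by
  rw [parity_bxor u v]
  congr 1
  rcases (foldedHypercube_adj_iff hd.pos.ne' u v).1 h with ⟨i, h⟩ | h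
  · simp [h, parity, bsingle]
  · simpa [h, parity] using ZMod.natCast_eq_one_iff_odd.2 hd

variable {K : Type*} [Field K]

/-- The weight of an edge of the folded hypercube as a function of its direction. -/
def directionWeight (r s : K) (m : Fin d → Bool) : K :=
  (∑ i, if m = bsingle i then r else 0) + if m = (fun _ => true) then s else 0

theorem directionWeight_ne_zero_iff {r s : K} (hr : r ≠ 0) (hs : s ≠ 0) (hrs : r + s = 1)
    (m : Fin d → Bool) :
    directionWeight r s m ≠ 0 ↔ (∃ i, m = bsingle i) ∨ m = fun _ => true := by
  have hsum : (∑ i, if m = bsingle i then r else 0) = if ∃ i, m = bsingle i then r else 0 := by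
    split_ifs with h
    · obtain ⟨i, rfl⟩ := h
      simp [bsingle_injective.eq_iff]
    · push Not at h
      simp [h]
  rw [directionWeight, hsum]
  split_ifs with h1 h2 h2 <;> simp [h1, h2, hr, hs, hrs]

theorem sum_directionWeight [CharP K 2] (hd : Odd d) {r s : K} (hrs : r + s = 1) :
    ∑ m : Fin d → Bool, directionWeight r s m = 1 := by
  simp only [directionWeight, Finset.sum_add_distrib]
  rw [Finset.sum_comm]
  simp only [Finset.sum_ite_eq', Finset.mem_univ, if_true, Finset.sum_const,
    Finset.card_univ, Fintype.card_fin, nsmul_eq_mul]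
  obtain ⟨a, rfl⟩ := hd
  push_cast
  rw [CharTwo.two_eq_zero, zero_mul, zero_add, one_mul, hrs]

theorem convolution_mul_self [CharP K 2] (c : (Fin d → Bool) → K) (hc : ∑ m, c m = 1) :
    (Matrix.of fun u v => c (bxor u v)) * (Matrix.of fun u v => c (bxor u v)) = 1 := by
  ext u w
  simp only [Matrix.mul_apply, Matrix.of_apply, Matrix.one_apply]
  split_ifs with h
  · subst h
    have hinv : Function.Involutive (bxor u) := bxor_bxor_cancel u
    rw [← Equiv.sum_comp hinv.toPerm]
    simp only [Function.Involutive.coe_toPerm, bxor_bxor_cancel, bxor_comm _ u]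
    simp only [← sq]
    rw [← CharTwo.sum_sq, hc, one_pow]
  · refine Finset.sum_involution (fun v _ => bxor (bxor u w) v) ?_ ?_ ?_ ?_
    · intro v _
      have e1 : bxor u (bxor (bxor u w) v) = bxor v w := by
        funext i
        simp only [bxor]
        cases u i <;> cases v i <;> cases w i <;> rfl
      have e2 : bxor (bxor (bxor u w) v) w = bxor u v := by
        funext i
        simp only [bxor]
        cases u i <;> cases v i <;> cases w i <;> rfl
      rw [e1, e2, mul_comm, CharTwo.add_self_eq_zero]
    · intro v _ _ hv
      refine h (funext fun i => ?_)
      have := congrFun hv i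
      simp only [bxor] at this
      revert this
      cases u i <;> cases v i <;> cases w i <;> decide
    · exact fun _ _ => Finset.mem_univ _
    · exact fun v _ => bxor_bxor_cancel _ v

end FoldedHypercube

theorem stmt12 (d : ℕ) (hd : Odd d) (k : ℕ) (hk : 2 ≤ k) :
    minForcingNumber (foldedHypercube d □ cycleGraph (2 * k)) = 2 ^ d := by
  obtain ⟨a, rfl⟩ := Nat.exists_eq_add_of_le' hk
  rw [show 2 * (a + 2) = 2 * a + 4 by ring]
  let K := AlgebraicClosure (ZMod 2)
  have : CharP K 2 := charP_of_injective_algebraMap (algebraMap (ZMod 2) K).injective 2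
  have : Infinite K := IsAlgClosed.instInfinite
  classical
  obtain ⟨r, hr⟩ := Infinite.exists_notMem_finset ({0, 1} : Finset K)
  simp only [Finset.mem_insert, Finset.mem_singleton, not_or] at hr
  have hs : 1 - r ≠ 0 := sub_ne_zero.2 (Ne.symm hr.2)
  have hrs : r + (1 - r) = 1 := by ring
  rw [minForcingNumber_boxProd_cycle (parity_of_adj hd) (even_two_mul a)
    (W := Matrix.of fun u v => directionWeight r (1 - r) (bxor u v)) ?_
    (convolution_mul_self _ (sum_directionWeight hd hrs))]
  · simp
  · intro u v
    rw [Matrix.of_apply, directionWeight_ne_zero_iff hr.1 hs hrs,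
      foldedHypercube_adj_iff hd.pos.ne']
end

section
/- For every integer n ≥ 2 with n ≠ 3 and every integer k ≥ 2, the minimum forcing number of the Cartesian product of the bipartite cocktail party graph BCP(n) with the cycle on 2k vertices satisfies f(BCP(n) □ C_{2k}) = 2n. -/
open SimpleGraph

def bipartiteCocktailParty (n : ℕ) : SimpleGraph (Fin n ⊕ Fin n) :=
  SimpleGraph.fromRel (fun u v => ∃ i j, i ≠ j ∧ u = Sum.inl i ∧ v = Sum.inr j)

/-- The spanning subgraph joining every vertex to its image under an involution. -/
def involutionSubgraph {V : Type*} (G : SimpleGraph V) (m : V → V) (hm : Function.Involutive m)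
    (hadj : ∀ v, G.Adj v (m v)) : G.Subgraph where
  verts := Set.univ
  Adj u v := m u = v
  adj_sub := by rintro u v rfl; exact hadj u
  edge_vert := fun _ => Set.mem_univ _
  symm := ⟨by rintro u v rfl; exact hm u⟩

theorem involutionSubgraph_isPerfectMatching {V : Type*} (G : SimpleGraph V) (m : V → V)
    (hm : Function.Involutive m) (hadj : ∀ v, G.Adj v (m v)) :
    (involutionSubgraph G m hm hadj).IsPerfectMatching := by
  rw [Subgraph.isPerfectMatching_iff]
  exact fun v => ⟨m v, rfl, fun w hw => Eq.symm hw⟩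

theorem exists_involutive_of_isPerfectMatching {V : Type*} {G : SimpleGraph V} {M : G.Subgraph}
    (hM : M.IsPerfectMatching) :
    ∃ m : V → V, Function.Involutive m ∧ ∀ u v, M.Adj u v ↔ m u = v := by
  rw [Subgraph.isPerfectMatching_iff] at hM
  choose m h1 h2 using hM
  have key : ∀ u v, M.Adj u v ↔ m u = v :=
    fun u v => ⟨fun h => (h2 u v h).symm, by rintro rfl; exact h1 u⟩
  exact ⟨m, fun v => (key _ _).1 (h1 v).symm, key⟩

/-- A fixed-point-free self-map of a finite nonempty set agrees with some nontrivial permutation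
off the fixed points of that permutation. -/
theorem exists_perm_ne_one_of_mapsTo {V : Type*} {T : Set V} (hT : T.Finite) (hne : T.Nonempty)
    (g : V → V) (hg : Set.MapsTo g T T) (hfix : ∀ x ∈ T, g x ≠ x) :
    ∃ σ : Equiv.Perm V, σ ≠ 1 ∧ ∀ x, σ x = x ∨ (x ∈ T ∧ σ x = g x) := by
  classical
  set C : Set V := T ∩ Function.periodicPts g with hC
  have hbij : Set.BijOn g C C := by
    refine ⟨fun x hx => ⟨hg hx.1, (Function.bijOn_periodicPts g).mapsTo hx.2⟩,
      (Function.bijOn_periodicPts g).injOn.mono Set.inter_subset_right, ?_⟩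
    rintro x ⟨hxT, hx⟩
    obtain ⟨n, hn, hp⟩ := Function.mem_periodicPts.1 hx
    obtain ⟨n, rfl⟩ : ∃ r, n = r + 1 := ⟨n - 1, by omega⟩
    refine ⟨g^[n] x, ⟨hg.iterate n hxT, ?_⟩, ?_⟩
    · exact Function.mk_mem_periodicPts hn (hp.apply_iterate n)
    · exact (Function.iterate_succ_apply' g n x).symm.trans hp
  obtain ⟨x, hx⟩ := hne
  obtain ⟨c, hc⟩ : C.Nonempty := by
    have := hT.to_subtype
    obtain ⟨i, j, hij, heq⟩ := Finite.exists_ne_map_eq_of_infinite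
      (fun i : ℕ => (⟨g^[i] x, hg.iterate i hx⟩ : T))
    have heq' : g^[i] x = g^[j] x := congrArg Subtype.val heq
    clear heq
    wlog hlt : i < j generalizing i j
    · exact this j i hij.symm heq'.symm (by omega)
    refine ⟨g^[i] x, hg.iterate i hx, Function.mk_mem_periodicPts (n := j - i) (by omega) ?_⟩
    rw [Function.IsPeriodicPt, Function.IsFixedPt, ← Function.iterate_add_apply,
      Nat.sub_add_cancel hlt.le, heq']
  have hσ : ∀ x ∈ C, Equiv.Perm.ofSubtype (Set.BijOn.equiv g hbij) x = g x := fun x hx => by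
    rw [Equiv.Perm.ofSubtype_apply_of_mem (p := (· ∈ C)) _ hx]; rfl
  refine ⟨Equiv.Perm.ofSubtype (Set.BijOn.equiv g hbij), fun h => ?_, fun x => ?_⟩
  · have := hσ c hc
    rw [h] at this
    exact hfix c hc.1 this.symm
  · by_cases hx : x ∈ C
    · exact Or.inr ⟨hx.1, hσ x hx⟩
    · exact Or.inl (Equiv.Perm.ofSubtype_apply_of_not_mem (p := (· ∈ C)) _ hx)

/-- If no vertex outside the colour class `Q` has exactly one neighbour in `T ⊆ Q`, then every
forcing set of a perfect matching covers a vertex of `T`. -/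
theorem exists_mem_edge_of_forcing {V : Type*} {G : SimpleGraph V} {M : G.Subgraph}
    (hM : M.IsPerfectMatching) {S : Set (Sym2 V)} (hS : S ⊆ M.edgeSet)
    (hforce : ∀ M' : G.Subgraph, M'.IsPerfectMatching → S ⊆ M'.edgeSet → M' = M)
    {Q T : Set V} (hQ : ∀ u v, G.Adj u v → (u ∈ Q ↔ v ∉ Q)) (hT : T.Finite) (hTne : T.Nonempty)
    (hTQ : T ⊆ Q) (h : ∀ p ∉ Q, ∀ q ∈ T, G.Adj p q → ∃ q' ∈ T, q' ≠ q ∧ G.Adj p q') :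
    ∃ q ∈ T, ∃ e ∈ S, q ∈ e := by
  classical
  by_contra! hno
  obtain ⟨m, hm, hMm⟩ := exists_involutive_of_isPerfectMatching hM
  have hadj : ∀ v, G.Adj v (m v) := fun v => M.adj_sub ((hMm v _).2 rfl)
  have hmQ : ∀ v, m v ∈ Q ↔ v ∉ Q := fun v => by have := hQ _ _ (hadj v); tauto
  have hg' : ∀ q, ∃ q', q ∈ T → q' ∈ T ∧ q' ≠ q ∧ G.Adj (m q) q' := fun q => by
    by_cases hq : q ∈ T
    · obtain ⟨q', h1, h2⟩ := h (m q) (fun hc => (hmQ q).1 hc (hTQ hq)) q hq (hadj q).symm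
      exact ⟨q', fun _ => ⟨h1, h2⟩⟩
    · exact ⟨q, fun hc => absurd hc hq⟩
  choose g hg using hg'
  obtain ⟨σ, hσ1, hσ⟩ := exists_perm_ne_one_of_mapsTo hT hTne g (fun x hx => (hg x hx).1)
    (fun x hx => (hg x hx).2.1)
  have hσT : ∀ x, x ∉ T → σ x = x := fun x hx => (hσ x).resolve_right fun hc => hx hc.1
  have hσTm : ∀ x, x ∈ T → σ x ∈ T := fun x hx => by
    rcases hσ x with e | ⟨_, e⟩ <;> rw [e]
    exacts [hx, (hg x hx).1]
  have hσQ : ∀ x, σ x ∈ Q ↔ x ∈ Q := fun x => by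
    by_cases hx : x ∈ T
    · simp [hTQ hx, hTQ (hσTm x hx)]
    · rw [hσT x hx]
  have hσadj : ∀ x, G.Adj (m x) (σ x) := fun x => by
    rcases hσ x with e | ⟨hx, e⟩ <;> rw [e]
    exacts [(hadj x).symm, (hg x hx).2.2]
  have hσ'Q : ∀ x, σ.symm x ∈ Q ↔ x ∈ Q := fun x => by
    rw [← hσQ, Equiv.apply_symm_apply]
  let μ : V → V := fun v => if v ∈ Q then m (σ.symm v) else σ (m v)
  have hμ : Function.Involutive μ := fun v => by
    by_cases hv : v ∈ Q
    · have : m (σ.symm v) ∉ Q := by rw [hmQ, hσ'Q]; simpa using hv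
      simp [μ, hv, this, hm _]
    · have : σ (m v) ∈ Q := by rw [hσQ, hmQ]; exact hv
      simp [μ, hv, this, hm _]
  have hμadj : ∀ v, G.Adj v (μ v) := fun v => by
    by_cases hv : v ∈ Q
    · simpa [μ, hv] using (hσadj (σ.symm v)).symm
    · simpa [μ, hv, hm v] using hσadj (m v)
  have heq := hforce _ (involutionSubgraph_isPerfectMatching G μ hμ hμadj) (by
    intro e he
    have heM := hS he
    induction e using Sym2.ind with
    | _ u v =>
      have huv : m u = v := (hMm u v).1 (Subgraph.mem_edgeSet.1 heM)
      have hu : u ∉ T := fun hu => hno u hu _ he (Sym2.mem_mk_left _ _)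
      have hv : v ∉ T := fun hv => hno v hv _ he (Sym2.mem_mk_right _ _)
      rw [Subgraph.mem_edgeSet]
      change μ u = v
      have e1 : σ.symm u = u := by rw [Equiv.symm_apply_eq, hσT u hu]
      by_cases hq : u ∈ Q
      · simp [μ, hq, e1, huv]
      · simp [μ, hq, huv, hσT v hv])
  apply hσ1
  ext x
  by_cases hx : x ∈ T
  · have h1 : M.Adj (m x) (σ x) := by
      rw [← heq]
      have : m x ∉ Q := fun hc => (hmQ x).1 hc (hTQ hx)
      change μ (m x) = _
      simp [μ, this, hm x]
    rw [hMm, hm] at h1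
    exact h1.symm
  · exact hσT x hx

/-- A linear lower bound for the size of forcing sets. -/
theorem finrank_le_ncard_of_forcing {V K E : Type*} [Finite V] [Field K] [AddCommGroup E]
    [Module K E] [FiniteDimensional K E] {G : SimpleGraph V} {M : G.Subgraph}
    (hM : M.IsPerfectMatching) {S : Set (Sym2 V)} (hS : S ⊆ M.edgeSet)
    (hforce : ∀ M' : G.Subgraph, M'.IsPerfectMatching → S ⊆ M'.edgeSet → M' = M)
    {Q : Set V} (hQ : ∀ u v, G.Adj u v → (u ∈ Q ↔ v ∉ Q)) (F : E →ₗ[K] V → K)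
    (hF : ∀ x, (∀ q ∈ Q, F x q = 0) → x = 0)
    (h : ∀ x, ∀ p ∉ Q, ∀ q, G.Adj p q → F x q ≠ 0 → ∃ q', q' ≠ q ∧ G.Adj p q' ∧ F x q' ≠ 0) :
    Module.finrank K E ≤ S.ncard := by
  classical
  cases nonempty_fintype V
  by_contra! hlt
  obtain ⟨m, hm, hMm⟩ := exists_involutive_of_isPerfectMatching hM
  have hadj : ∀ v, G.Adj v (m v) := fun v => M.adj_sub ((hMm v _).2 rfl)
  have hmQ : ∀ v, m v ∈ Q ↔ v ∉ Q := fun v => by have := hQ _ _ (hadj v); tauto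
  let R : Set V := {q | q ∈ Q ∧ s(q, m q) ∈ S}
  have hR : R.ncard ≤ S.ncard := by
    refine Set.ncard_le_ncard_of_injOn (fun q => s(q, m q)) (fun q hq => hq.2) ?_ (Set.toFinite S)
    intro q hq q' hq' he
    rcases Sym2.eq_iff.1 he with ⟨e, _⟩ | ⟨e, _⟩
    · exact e
    · exact absurd hq'.1 ((hmQ q').1 (e ▸ hq.1))
  let L : E →ₗ[K] R → K := (LinearMap.funLeft K K (Subtype.val : R → V)).comp F
  have hker : LinearMap.ker L ≠ ⊥ := LinearMap.ker_ne_bot_of_finrank_lt (by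
    rw [Module.finrank_fintype_fun_eq_card, ← Nat.card_eq_fintype_card]
    exact lt_of_le_of_lt hR hlt)
  obtain ⟨x, hx, hx0⟩ := (Submodule.ne_bot_iff _).1 hker
  obtain ⟨q, hqT, e, he, hqe⟩ := exists_mem_edge_of_forcing hM hS hforce hQ
    (T := {q | q ∈ Q ∧ F x q ≠ 0}) (Set.toFinite _) (by
      by_contra hne
      refine hx0 (hF x fun q hq => ?_)
      by_contra hc
      exact hne ⟨q, hq, hc⟩) (fun q hq => hq.1) (by
      rintro p hp q ⟨hq, hq0⟩ hpq
      obtain ⟨q', h1, h2, h3⟩ := h x p hp q hpq hq0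
      exact ⟨q', ⟨by have := hQ _ _ h2; tauto, h3⟩, h1, h2⟩)
  obtain ⟨w, rfl⟩ := Sym2.mem_iff_exists.1 hqe
  have hw : m q = w := (hMm q w).1 (Subgraph.mem_edgeSet.1 (hS he))
  subst hw
  exact hqT.2 (congrFun (LinearMap.mem_ker.1 hx) ⟨q, hqT.1, he⟩)

@[simp]
theorem bipartiteCocktailParty_adj_inl_inr {n : ℕ} (i j : Fin n) :
    (bipartiteCocktailParty n).Adj (.inl i) (.inr j) ↔ i ≠ j := by
  simp [bipartiteCocktailParty]

@[simp]
theorem bipartiteCocktailParty_adj_inr_inl {n : ℕ} (i j : Fin n) :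
    (bipartiteCocktailParty n).Adj (.inr i) (.inl j) ↔ i ≠ j := by
  rw [adj_comm, bipartiteCocktailParty_adj_inl_inr, ne_comm]

@[simp]
theorem bipartiteCocktailParty_not_adj_inl_inl {n : ℕ} (i j : Fin n) :
    ¬ (bipartiteCocktailParty n).Adj (.inl i) (.inl j) := by
  simp [bipartiteCocktailParty]

@[simp]
theorem bipartiteCocktailParty_not_adj_inr_inr {n : ℕ} (i j : Fin n) :
    ¬ (bipartiteCocktailParty n).Adj (.inr i) (.inr j) := by
  simp [bipartiteCocktailParty]

theorem bipartiteCocktailParty_isRight_iff {n : ℕ} {u v : Fin n ⊕ Fin n}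
    (h : (bipartiteCocktailParty n).Adj u v) : u.isRight ↔ ¬ v.isRight := by
  rcases u with i | i <;> rcases v with j | j <;> simp_all

/-- The linear extension of a function on the `y`-side by the sums over neighbours. -/
def neighborSumExtension (K : Type*) [Field K] (n : ℕ) :
    (Fin n → K) →ₗ[K] (Fin n ⊕ Fin n → K) where
  toFun f := Sum.elim (fun i => ∑ j, f j - f i) f
  map_add' f g := by
    funext i
    rcases i with i | i
    · simp [Finset.sum_add_distrib]; ring
    · simp
  map_smul' c f := by
    funext i
    rcases i with i | i
    · simp [← Finset.mul_sum]; ring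
    · simp

open Classical in
theorem neighborSumExtension_eq_sum {K : Type*} [Field K] {n : ℕ} (hn : (n : K) = 2)
    (f : Fin n → K) (v : Fin n ⊕ Fin n) :
    neighborSumExtension K n f v = ∑ u, if (bipartiteCocktailParty n).Adj v u then
      neighborSumExtension K n f u else 0 := by
  have key : ∀ (g : Fin n → K) (i : Fin n), (∑ j, if i ≠ j then g j else 0) = ∑ j, g j - g i := by
    intro g i
    have h : ∀ j, (if i ≠ j then g j else 0) = g j - if i = j then g j else 0 := fun j => by
      split_ifs <;> simp_all
    simp only [h, Finset.sum_sub_distrib, Finset.sum_ite_eq, Finset.mem_univ, if_true]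
  rcases v with i | i
  · simp only [Fintype.sum_sum_type, bipartiteCocktailParty_not_adj_inl_inl,
      bipartiteCocktailParty_adj_inl_inr, if_false, Finset.sum_const_zero, zero_add, key]
    rfl
  · simp only [Fintype.sum_sum_type, bipartiteCocktailParty_not_adj_inr_inr,
      bipartiteCocktailParty_adj_inr_inl, if_false, Finset.sum_const_zero, add_zero, key]
    simp [neighborSumExtension, hn]
    ring

theorem exists_adj_of_neighborSumExtension_ne_zero {K : Type*} [Field K] {n : ℕ}
    (hn : (n : K) = 2) {f : Fin n → K} {v : Fin n ⊕ Fin n}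
    (h : neighborSumExtension K n f v ≠ 0) :
    ∃ u, (bipartiteCocktailParty n).Adj v u ∧ neighborSumExtension K n f u ≠ 0 := by
  classical
  by_contra! hc
  refine h ((neighborSumExtension_eq_sum hn f v).trans (Finset.sum_eq_zero fun u _ => ?_))
  split_ifs with hu
  exacts [hc u hu, rfl]

theorem exists_adj_ne_of_neighborSumExtension_eq_zero {K : Type*} [Field K] {n : ℕ}
    (hn : (n : K) = 2) {f : Fin n → K} {v u : Fin n ⊕ Fin n}
    (h : neighborSumExtension K n f v = 0) (huv : (bipartiteCocktailParty n).Adj v u)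
    (hu : neighborSumExtension K n f u ≠ 0) :
    ∃ u', u' ≠ u ∧ (bipartiteCocktailParty n).Adj v u' ∧ neighborSumExtension K n f u' ≠ 0 := by
  classical
  by_contra! hc
  rw [neighborSumExtension_eq_sum hn f v, Finset.sum_eq_single u, if_pos huv] at h
  · exact hu h
  · intro u' _ hne
    split_ifs with hadj
    exacts [hc u' hne hadj, rfl]
  · simp

/-- A colour class of the product of the bipartite cocktail party graph and an even cycle. -/
def rightEvenClass (n m : ℕ) : Set ((Fin n ⊕ Fin n) × Fin (m + 2)) :=
  {p | p.1.isRight ↔ Even p.2.val}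

theorem even_val_add_one {m : ℕ} (hm : Even m) (j : Fin (m + 2)) :
    Even (j + 1).val ↔ ¬ Even j.val := by
  obtain ⟨r, rfl⟩ := hm
  have : (1 : Fin (r + r + 2)).val = 1 := rfl
  rw [Fin.val_add, this, Nat.even_iff, Nat.even_iff, Nat.mod_mod_of_dvd _ (by omega)]
  omega

theorem mem_rightEvenClass_add_one {n m : ℕ} (hm : Even m) (v : Fin n ⊕ Fin n) (j : Fin (m + 2)) :
    (v, j + 1) ∈ rightEvenClass n m ↔ (v, j) ∉ rightEvenClass n m := by
  have := even_val_add_one hm j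
  simp only [rightEvenClass, Set.mem_ofPred_eq]
  tauto

theorem mem_rightEvenClass_sub_one {n m : ℕ} (hm : Even m) (v : Fin n ⊕ Fin n) (j : Fin (m + 2)) :
    (v, j - 1) ∈ rightEvenClass n m ↔ (v, j) ∉ rightEvenClass n m := by
  have := mem_rightEvenClass_add_one hm v (j - 1)
  rw [sub_add_cancel] at this
  tauto

theorem boxProd_cycleGraph_adj {W : Type*} {G : SimpleGraph W} {m : ℕ} {p q : W × Fin (m + 2)} :
    (G □ cycleGraph (m + 2)).Adj p q ↔
      (G.Adj p.1 q.1 ∧ q = (q.1, p.2)) ∨ q = (p.1, p.2 + 1) ∨ q = (p.1, p.2 - 1) := by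
  obtain ⟨u, i⟩ := p
  obtain ⟨v, j⟩ := q
  rw [boxProd_adj, cycleGraph_adj]
  simp only [Prod.mk.injEq, true_and]
  constructor
  · rintro (⟨h, rfl⟩ | ⟨h | h, rfl⟩)
    · exact Or.inl ⟨h, rfl⟩
    · exact Or.inr (Or.inr ⟨rfl, by rw [← h]; abel⟩)
    · exact Or.inr (Or.inl ⟨rfl, by rw [← h]; abel⟩)
  · rintro (⟨h, rfl⟩ | ⟨rfl, rfl⟩ | ⟨rfl, rfl⟩)
    · exact Or.inl ⟨h, rfl⟩
    · exact Or.inr ⟨Or.inr (by abel), rfl⟩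
    · exact Or.inr ⟨Or.inl (by abel), rfl⟩

theorem mem_rightEvenClass_of_adj {n m : ℕ} (hm : Even m)
    {p q : (Fin n ⊕ Fin n) × Fin (m + 2)}
    (h : (bipartiteCocktailParty n □ cycleGraph (m + 2)).Adj p q) :
    p ∈ rightEvenClass n m ↔ q ∉ rightEvenClass n m := by
  obtain ⟨u, i⟩ := p
  rcases boxProd_cycleGraph_adj.1 h with ⟨h, hq⟩ | rfl | rfl
  · rw [hq]
    have := bipartiteCocktailParty_isRight_iff h
    simp only [rightEvenClass, Set.mem_ofPred_eq] at this ⊢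
    tauto
  · rw [mem_rightEvenClass_add_one hm, not_not]
  · rw [mem_rightEvenClass_sub_one hm, not_not]

theorem fin_sub_one_ne_add_one {m : ℕ} (hm : 1 ≤ m) (j : Fin (m + 2)) : j - 1 ≠ j + 1 := by
  intro h
  have h2 : (1 : Fin (m + 2)) + 1 = 0 := by
    have : (j + 1) - (j - 1) = 0 := by rw [h, sub_self]
    rw [← this]; abel
  have := congrArg Fin.val h2
  rw [Fin.val_add] at this
  simp [Nat.mod_eq_of_lt (show 1 + 1 < m + 2 by omega)] at this

/-- A family of weighted kernel vectors of the product graph, where `t` parametrizes the layers. -/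
def layerKernelMap {K : Type*} [Field K] (n m : ℕ) (t : Fin (m + 2) → K) :
    ((Fin n → K) × (Fin n → K)) →ₗ[K] ((Fin n ⊕ Fin n) × Fin (m + 2) → K) :=
  LinearMap.pi fun p => (LinearMap.proj p.1).comp ((neighborSumExtension K n).comp
    (LinearMap.fst K _ _ + t p.2 • LinearMap.snd K _ _))

theorem layerKernelMap_apply {K : Type*} [Field K] {n m : ℕ} (t : Fin (m + 2) → K)
    (x : (Fin n → K) × (Fin n → K)) (v : Fin n ⊕ Fin n) (j : Fin (m + 2)) :
    layerKernelMap n m t x (v, j) = neighborSumExtension K n (x.1 + t j • x.2) v := rfl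

theorem layerKernelMap_relation {K : Type*} [Field K] {n m : ℕ} (t : Fin (m + 2) → K)
    (x : (Fin n → K) × (Fin n → K)) (v : Fin n ⊕ Fin n) (i j l : Fin (m + 2)) :
    (t l - t j) * layerKernelMap n m t x (v, i) + (t i - t l) * layerKernelMap n m t x (v, j) +
      (t j - t i) * layerKernelMap n m t x (v, l) = 0 := by
  simp only [layerKernelMap_apply, map_add, map_smul, Pi.add_apply, Pi.smul_apply, smul_eq_mul]
  ring

theorem eq_zero_of_layerKernelMap_eq_zero {K : Type*} [Field K] {n m : ℕ} (hm : Even m)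
    (hm2 : 1 ≤ m) {t : Fin (m + 2) → K} (ht : Function.Injective t)
    {x : (Fin n → K) × (Fin n → K)}
    (h : ∀ q ∈ rightEvenClass n m, layerKernelMap n m t x q = 0) : x = 0 := by
  have key : ∀ i (j : Fin (m + 2)), Even j.val → x.1 i + t j * x.2 i = 0 := fun i j hj =>
    h (.inr i, j) (by simp [rightEvenClass, hj])
  have h0 : Even (0 : Fin (m + 2)).val := by simp
  have h2 : Even (0 + 1 + 1 : Fin (m + 2)).val := by
    rw [even_val_add_one hm, even_val_add_one hm]; simp
  have hne : t 0 - t (0 + 1 + 1) ≠ 0 := sub_ne_zero.2 fun hc => by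
    have := ht hc
    exact fin_sub_one_ne_add_one hm2 (0 + 1) (by rw [add_sub_cancel_right]; exact this)
  have hb : ∀ i, x.2 i = 0 := fun i => by
    have : (t 0 - t (0 + 1 + 1)) * x.2 i = 0 := by linear_combination key i _ h0 - key i _ h2
    exact (mul_eq_zero.1 this).resolve_left hne
  refine Prod.ext (funext fun i => ?_) (funext hb)
  simpa [hb i] using key i _ h0

theorem exists_adj_ne_layerKernelMap_ne_zero {K : Type*} [Field K] {n m : ℕ} (hn : (n : K) = 2)
    (hm2 : 1 ≤ m) {t : Fin (m + 2) → K} (ht : Function.Injective t)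
    (x : (Fin n → K) × (Fin n → K)) {p q : (Fin n ⊕ Fin n) × Fin (m + 2)}
    (hpq : (bipartiteCocktailParty n □ cycleGraph (m + 2)).Adj p q)
    (hq : layerKernelMap n m t x q ≠ 0) :
    ∃ q', q' ≠ q ∧ (bipartiteCocktailParty n □ cycleGraph (m + 2)).Adj p q' ∧
      layerKernelMap n m t x q' ≠ 0 := by
  obtain ⟨v, j⟩ := p
  have hrel := layerKernelMap_relation t x v (j - 1) j (j + 1)
  have hj1 : j ≠ j + 1 := by simp
  have hj2 : j ≠ j - 1 := fun h => by simpa using eq_sub_iff_add_eq.1 h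
  have hj3 := fin_sub_one_ne_add_one hm2 j
  have hc1 : t (j + 1) - t j ≠ 0 := sub_ne_zero.2 fun h => hj1 (ht h).symm
  have hc2 : t (j - 1) - t (j + 1) ≠ 0 := sub_ne_zero.2 fun h => hj3 (ht h)
  have hc3 : t j - t (j - 1) ≠ 0 := sub_ne_zero.2 fun h => hj2 (ht h)
  have hadd : (bipartiteCocktailParty n □ cycleGraph (m + 2)).Adj (v, j) (v, j + 1) :=
    boxProd_cycleGraph_adj.2 (Or.inr (Or.inl rfl))
  have hsub : (bipartiteCocktailParty n □ cycleGraph (m + 2)).Adj (v, j) (v, j - 1) :=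
    boxProd_cycleGraph_adj.2 (Or.inr (Or.inr rfl))
  have hlayer : layerKernelMap n m t x (v, j) ≠ 0 →
      ∃ u, (bipartiteCocktailParty n □ cycleGraph (m + 2)).Adj (v, j) (u, j) ∧
        layerKernelMap n m t x (u, j) ≠ 0 := fun h => by
    obtain ⟨u, hu, hu0⟩ := exists_adj_of_neighborSumExtension_ne_zero hn h
    exact ⟨u, boxProd_cycleGraph_adj.2 (Or.inl ⟨hu, rfl⟩), hu0⟩
  rcases boxProd_cycleGraph_adj.1 hpq with ⟨h, he⟩ | rfl | rfl
  · obtain ⟨u, l⟩ := q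
    obtain rfl : l = j := congrArg Prod.snd he
    by_cases h0 : layerKernelMap n m t x (v, l) = 0
    · obtain ⟨u', h1, h2, h3⟩ := exists_adj_ne_of_neighborSumExtension_eq_zero hn h0 h hq
      exact ⟨(u', l), by simpa using h1, boxProd_cycleGraph_adj.2 (Or.inl ⟨h2, rfl⟩), h3⟩
    · by_cases h1 : layerKernelMap n m t x (v, l + 1) = 0
      · refine ⟨(v, l - 1), fun hc => hj2 (congrArg Prod.snd hc).symm, hsub, fun h2 => ?_⟩
        simp_all
      · exact ⟨(v, l + 1), fun hc => hj1 (congrArg Prod.snd hc).symm, hadd, h1⟩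
  · by_cases h0 : layerKernelMap n m t x (v, j) = 0
    · refine ⟨(v, j - 1), fun hc => hj3 (congrArg Prod.snd hc), hsub, fun h2 => ?_⟩
      simp_all
    · obtain ⟨u, hu, hu0⟩ := hlayer h0
      exact ⟨(u, j), fun hc => hj1 (congrArg Prod.snd hc), hu, hu0⟩
  · by_cases h0 : layerKernelMap n m t x (v, j) = 0
    · refine ⟨(v, j + 1), fun hc => hj3 (congrArg Prod.snd hc).symm, hadd, fun h2 => ?_⟩
      simp_all
    · obtain ⟨u, hu, hu0⟩ := hlayer h0
      exact ⟨(u, j), fun hc => hj2 (congrArg Prod.snd hc), hu, hu0⟩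

theorem exists_infinite_field_natCast_eq_two {n : ℕ} (hn : 2 ≤ n) (hn3 : n ≠ 3) :
    ∃ (K : Type) (_ : Field K), Infinite K ∧ (n : K) = 2 := by
  obtain ⟨p, hp, hdvd⟩ := Nat.exists_prime_and_dvd (n := n - 2) (by omega)
  have : Fact p.Prime := ⟨hp⟩
  refine ⟨AlgebraicClosure (ZMod p), inferInstance, inferInstance, ?_⟩
  have h0 : ((n - 2 : ℕ) : AlgebraicClosure (ZMod p)) = 0 := by
    rw [CharP.cast_eq_zero_iff _ p]; exact hdvd
  rw [Nat.cast_sub hn, sub_eq_zero] at h0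
  simpa using h0

theorem two_mul_le_ncard_of_forcing {n m : ℕ} (hn : 2 ≤ n) (hn3 : n ≠ 3) (hm : Even m)
    (hm2 : 1 ≤ m) {M : (bipartiteCocktailParty n □ cycleGraph (m + 2)).Subgraph}
    (hM : M.IsPerfectMatching) {S : Set (Sym2 ((Fin n ⊕ Fin n) × Fin (m + 2)))}
    (hS : S ⊆ M.edgeSet)
    (hforce : ∀ M' : (bipartiteCocktailParty n □ cycleGraph (m + 2)).Subgraph,
      M'.IsPerfectMatching → S ⊆ M'.edgeSet → M' = M) : 2 * n ≤ S.ncard := by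
  obtain ⟨K, _, _, hK⟩ := exists_infinite_field_natCast_eq_two hn hn3
  let t : Fin (m + 2) → K := fun j => Infinite.natEmbedding K j.val
  have ht : Function.Injective t := (Infinite.natEmbedding K).injective.comp Fin.val_injective
  have := finrank_le_ncard_of_forcing hM hS hforce
    (fun _ _ h => mem_rightEvenClass_of_adj hm h) (layerKernelMap n m t)
    (fun _ h => eq_zero_of_layerKernelMap_eq_zero hm hm2 ht h)
    (fun x _ _ _ h h0 => exists_adj_ne_layerKernelMap_ne_zero hK hm2 ht x h h0)
  simpa [two_mul] using this

open Classical in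
/-- The fibrewise matching of the product joining each vertex outside `rightEvenClass`
to the next layer. -/
noncomputable def shiftPartner (n m : ℕ) (p : (Fin n ⊕ Fin n) × Fin (m + 2)) :
    (Fin n ⊕ Fin n) × Fin (m + 2) :=
  if p ∈ rightEvenClass n m then (p.1, p.2 - 1) else (p.1, p.2 + 1)

theorem shiftPartner_involutive (n : ℕ) {m : ℕ} (hm : Even m) :
    Function.Involutive (shiftPartner n m) := by
  rintro ⟨v, j⟩
  by_cases h : (v, j) ∈ rightEvenClass n m
  · simp [shiftPartner, h, mem_rightEvenClass_sub_one hm]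
  · simp [shiftPartner, h, mem_rightEvenClass_add_one hm]

theorem adj_shiftPartner (n m : ℕ) (p : (Fin n ⊕ Fin n) × Fin (m + 2)) :
    (bipartiteCocktailParty n □ cycleGraph (m + 2)).Adj p (shiftPartner n m p) := by
  rw [boxProd_cycleGraph_adj, shiftPartner]
  split_ifs <;> simp

/-- One edge in each fibre: the edges of the shift matching meeting the first layer. -/
def firstLayerEdge (n m : ℕ) : Fin n ⊕ Fin n → Sym2 ((Fin n ⊕ Fin n) × Fin (m + 2)) :=
  fun v => if v.isRight then s((v, 0 - 1), (v, 0)) else s((v, 0), (v, 0 + 1))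

theorem eq_shiftPartner_of_firstLayer {n m : ℕ} (hm : Even m) (hm2 : 1 ≤ m)
    {μ : (Fin n ⊕ Fin n) × Fin (m + 2) → (Fin n ⊕ Fin n) × Fin (m + 2)}
    (hμ : Function.Involutive μ)
    (hadj : ∀ p, (bipartiteCocktailParty n □ cycleGraph (m + 2)).Adj p (μ p))
    (hl : ∀ i, μ (.inl i, 0) = (.inl i, 0 + 1)) (hr : ∀ i, μ (.inr i, 0 - 1) = (.inr i, 0)) :
    μ = shiftPartner n m := by
  have step : ∀ j : Fin (m + 2), ∀ v,
      ((v, j - 1) ∉ rightEvenClass n m → μ (v, j - 1) = (v, j)) ∧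
      ((v, j) ∉ rightEvenClass n m → μ (v, j) = (v, j + 1)) := by
    intro j
    induction j using Fin.induction with
    | zero =>
      rintro (i | i)
      · rw [mem_rightEvenClass_sub_one hm]
        simpa [rightEvenClass] using hl i
      · rw [mem_rightEvenClass_sub_one hm]
        simpa [rightEvenClass] using hr i
    | succ i ih =>
      rw [← Fin.coeSucc_eq_succ]
      generalize i.castSucc = j at ih
      intro v
      rw [add_sub_cancel_right]
      refine ⟨(ih v).2, fun hv => ?_⟩
      rcases boxProd_cycleGraph_adj.1 (hadj (v, j + 1)) with ⟨h, he⟩ | he | he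
      · have hu : ((μ (v, j + 1)).1, j) ∉ rightEvenClass n m := by
          rw [← mem_rightEvenClass_add_one hm, ← he]
          have := mem_rightEvenClass_of_adj hm (hadj (v, j + 1))
          tauto
        have := congrArg Prod.snd (hμ.injective (he.trans ((ih _).2 hu).symm))
        simp at this
      · exact he
      · simp only [add_sub_cancel_right] at he
        have hu : (v, j - 1) ∉ rightEvenClass n m := by
          rw [mem_rightEvenClass_sub_one hm, ← mem_rightEvenClass_add_one hm]; exact hv
        have := congrArg Prod.snd (hμ.injective (he.trans ((ih _).1 hu).symm))
        exact absurd this.symm (fin_sub_one_ne_add_one hm2 j)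
  have hout : ∀ p ∉ rightEvenClass n m, μ p = shiftPartner n m p := by
    rintro ⟨v, j⟩ hp
    rw [(step j v).2 hp, shiftPartner, if_neg hp]
  funext p
  by_cases hp : p ∈ rightEvenClass n m
  · have hp' : shiftPartner n m p ∉ rightEvenClass n m :=
      (mem_rightEvenClass_of_adj hm (adj_shiftPartner n m p)).1 hp
    have := hout _ hp'
    rw [shiftPartner_involutive n hm p] at this
    rw [← hμ (shiftPartner n m p), this]
  · exact hout p hp

/-- The shift matching has a forcing set with one edge in each fibre. -/
theorem exists_forcing_ncard_le {n m : ℕ} (hm : Even m) (hm2 : 1 ≤ m) :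
    ∃ M : (bipartiteCocktailParty n □ cycleGraph (m + 2)).Subgraph, M.IsPerfectMatching ∧
      ∃ S : Set (Sym2 ((Fin n ⊕ Fin n) × Fin (m + 2))), S ⊆ M.edgeSet ∧ S.ncard ≤ 2 * n ∧
        ∀ M' : (bipartiteCocktailParty n □ cycleGraph (m + 2)).Subgraph,
          M'.IsPerfectMatching → S ⊆ M'.edgeSet → M' = M := by
  refine ⟨_, involutionSubgraph_isPerfectMatching _ _ (shiftPartner_involutive n hm)
    (adj_shiftPartner n m), Set.range (firstLayerEdge n m), ?_, ?_, ?_⟩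
  · rintro _ ⟨i | i, rfl⟩
    · change shiftPartner n m (.inl i, 0) = (.inl i, 0 + 1)
      simp [shiftPartner, rightEvenClass]
    · have h : ((.inr i, 0 - 1) : (Fin n ⊕ Fin n) × Fin (m + 2)) ∉ rightEvenClass n m := by
        rw [mem_rightEvenClass_sub_one hm]
        simp [rightEvenClass]
      change shiftPartner n m (.inr i, 0 - 1) = (.inr i, 0)
      rw [shiftPartner, if_neg h]
      simp
  · rw [← Set.image_univ]
    refine (Set.ncard_image_le Set.finite_univ).trans ?_
    simp [Set.ncard_univ, two_mul]
  · intro M' hM' hS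
    obtain ⟨μ, hμ, hMμ⟩ := exists_involutive_of_isPerfectMatching hM'
    have hshift : μ = shiftPartner n m :=
      eq_shiftPartner_of_firstLayer hm hm2 hμ (fun p => M'.adj_sub ((hMμ p _).2 rfl))
        (fun i => (hMμ _ _).1 (hS ⟨.inl i, rfl⟩)) (fun i => (hMμ _ _).1 (hS ⟨.inr i, rfl⟩))
    ext u v
    · exact iff_of_true (hM'.2 u) trivial
    · rw [hMμ, hshift]
      rfl

theorem minForcingNumber_eq {V : Type*} {G : SimpleGraph V} {c : ℕ}
    (hlow : ∀ M : G.Subgraph, M.IsPerfectMatching → ∀ S ⊆ M.edgeSet,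
      (∀ M' : G.Subgraph, M'.IsPerfectMatching → S ⊆ M'.edgeSet → M' = M) → c ≤ S.ncard)
    (hup : ∃ M : G.Subgraph, M.IsPerfectMatching ∧ ∃ S ⊆ M.edgeSet, S.ncard ≤ c ∧
      ∀ M' : G.Subgraph, M'.IsPerfectMatching → S ⊆ M'.edgeSet → M' = M) :
    minForcingNumber G = c := by
  obtain ⟨M₀, hM₀, S₀, hS₀, hcard, hforce⟩ := hup
  apply le_antisymm
  · calc minForcingNumber G ≤ forcingNumber G M₀ := Nat.sInf_le ⟨M₀, hM₀, rfl⟩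
      _ ≤ S₀.ncard := Nat.sInf_le ⟨S₀, hS₀, rfl, hforce⟩
      _ ≤ c := hcard
  · refine le_csInf ⟨_, M₀, hM₀, rfl⟩ ?_
    rintro _ ⟨M, hM, rfl⟩
    refine le_csInf ⟨_, M.edgeSet, subset_rfl, rfl, fun M' hM' hsub => ?_⟩ ?_
    · obtain ⟨m, -, hMm⟩ := exists_involutive_of_isPerfectMatching hM
      obtain ⟨m', -, hMm'⟩ := exists_involutive_of_isPerfectMatching hM'
      have : m' = m := funext fun v =>
        (hMm' v _).1 (hsub (Subgraph.mem_edgeSet.2 ((hMm v _).2 rfl)))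
      ext u v
      · exact iff_of_true (hM'.2 u) (hM.2 u)
      · rw [hMm, hMm', this]
    · rintro _ ⟨S, hS, rfl, hS'⟩
      exact hlow M hM S hS hS'

theorem stmt14 (n : ℕ) (hn : 2 ≤ n) (hn3 : n ≠ 3) (k : ℕ) (hk : 2 ≤ k) :
    minForcingNumber (bipartiteCocktailParty n □ cycleGraph (2 * k)) = 2 * n := by
  obtain ⟨m, hkm⟩ : ∃ m, 2 * k = m + 2 := ⟨2 * k - 2, by omega⟩
  have hm : Even m := by rw [Nat.even_iff]; omega
  have hm2 : 1 ≤ m := by omega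
  rw [hkm]
  exact minForcingNumber_eq
    (fun _ hM _ hS hforce => two_mul_le_ncard_of_forcing hn hn3 hm hm2 hM hS hforce)
    (exists_forcing_ncard_le hm hm2)
end

section
/- For every integer n ≥ 1, the minimum forcing number of the prism over the star K_{1,n} satisfies f(K_{1,n} □ K_2) = 1. -/
open SimpleGraph

namespace SimpleGraph.Subgraph

variable {V : Type*} {G : SimpleGraph V}

/-- The subgraph whose edges join each vertex to its image under an involution. -/
def ofInvolutive (f : V → V) (hf : Function.Involutive f) (hG : ∀ v, G.Adj v (f v)) :
    G.Subgraph where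
  verts := Set.univ
  Adj a b := f a = b
  adj_sub := by rintro a _ rfl; exact hG a
  edge_vert _ := Set.mem_univ _
  symm := ⟨by rintro a _ rfl; exact hf a⟩

theorem isPerfectMatching_ofInvolutive (f : V → V) (hf : Function.Involutive f)
    (hG : ∀ v, G.Adj v (f v)) : (ofInvolutive f hf hG).IsPerfectMatching :=
  isPerfectMatching_iff.2 fun v => ⟨f v, rfl, fun _ h => Eq.symm h⟩

theorem IsPerfectMatching.eq_of_adj_imp_s16 {M M' : G.Subgraph} (hM : M.IsPerfectMatching)
    (hM' : M'.IsPerfectMatching) (h : ∀ a b, M.Adj a b → M'.Adj a b) : M' = M := by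
  refine Subgraph.ext (hM'.2.verts_eq_univ.trans hM.2.verts_eq_univ.symm) ?_
  ext a b
  refine ⟨fun hab => ?_, h a b⟩
  obtain ⟨c, hc, -⟩ := isPerfectMatching_iff.1 hM a
  rwa [(isPerfectMatching_iff.1 hM' a).unique hab (h a c hc)]

end SimpleGraph.Subgraph

open SimpleGraph.Subgraph

theorem one_le_forcingNumber {V : Type*} [Finite V] {G : SimpleGraph V} {M M₀ M₁ : G.Subgraph}
    (hM : M.IsPerfectMatching) (h₀ : M₀.IsPerfectMatching) (h₁ : M₁.IsPerfectMatching)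
    (hne : M₀ ≠ M₁) : 1 ≤ forcingNumber G M := by
  rw [Nat.one_le_iff_ne_zero]
  intro h
  rcases Nat.sInf_eq_zero.1 h with ⟨S, -, hS, hforce⟩ | h
  · rw [Set.ncard_eq_zero (Set.toFinite S)] at hS
    subst hS
    exact hne ((hforce M₀ h₀ (Set.empty_subset _)).trans (hforce M₁ h₁ (Set.empty_subset _)).symm)
  · refine Set.eq_empty_iff_forall_notMem.1 h M.edgeSet.ncard
      ⟨M.edgeSet, subset_rfl, rfl, fun M' hM' hsub => hM.eq_of_adj_imp_s16 hM' fun a b hab => ?_⟩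
    exact Subgraph.mem_edgeSet.1 (hsub (Subgraph.mem_edgeSet.2 hab))

/-- Exchange the two copies of every vertex of the prism. -/
def prismFlip {α : Type*} (v : α × Fin 2) : α × Fin 2 := (v.1, v.2 + 1)

/-- Exchange the center with the leaf `0` in both copies, and the two copies of other leaves. -/
def starPrismSwap {m : ℕ} : (Fin 1 ⊕ Fin (m + 1)) × Fin 2 → (Fin 1 ⊕ Fin (m + 1)) × Fin 2
  | (.inl _, j) => (.inr 0, j)
  | (.inr i, j) => if i = 0 then (.inl 0, j) else (.inr i, j + 1)

theorem fin_two_add_one_add_one (j : Fin 2) : j + 1 + 1 = j := by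
  fin_cases j <;> rfl

theorem fin_two_ne_add_one (j : Fin 2) : j ≠ j + 1 := by
  fin_cases j <;> decide

theorem prismFlip_involutive {α : Type*} : Function.Involutive (prismFlip (α := α)) := by
  rintro ⟨x, j⟩
  simp [prismFlip, fin_two_add_one_add_one]

theorem adj_prismFlip {α : Type*} (G : SimpleGraph α) (v : α × Fin 2) :
    (G □ (⊤ : SimpleGraph (Fin 2))).Adj v (prismFlip v) :=
  boxProd_adj.2 (Or.inr ⟨fin_two_ne_add_one v.2, rfl⟩)

theorem starPrismSwap_involutive {m : ℕ} : Function.Involutive (starPrismSwap (m := m)) := by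
  rintro ⟨x | i, j⟩
  · simp [starPrismSwap, Subsingleton.elim x 0]
  · by_cases hi : i = 0 <;> simp [starPrismSwap, hi, fin_two_add_one_add_one]

theorem adj_starPrismSwap {m : ℕ} (v : (Fin 1 ⊕ Fin (m + 1)) × Fin 2) :
    (completeBipartiteGraph (Fin 1) (Fin (m + 1)) □ (⊤ : SimpleGraph (Fin 2))).Adj v
      (starPrismSwap v) := by
  obtain ⟨x | i, j⟩ := v
  · simp [starPrismSwap, boxProd_adj]
  · by_cases hi : i = 0 <;> simp [starPrismSwap, boxProd_adj, hi]

/-- A perfect matching of a star prism containing the edge between the two centers joins the two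
copies of every vertex. -/
theorem adj_prismFlip_of_adj_center {n : ℕ}
    {M : (completeBipartiteGraph (Fin 1) (Fin n) □ (⊤ : SimpleGraph (Fin 2))).Subgraph}
    (hM : M.IsPerfectMatching) (hc : M.Adj (.inl 0, 0) (.inl 0, 1))
    (v : (Fin 1 ⊕ Fin n) × Fin 2) : M.Adj v (prismFlip v) := by
  have hcenter (j : Fin 2) : M.Adj (.inl 0, j) (.inl 0, j + 1) := by
    fin_cases j
    · exact hc
    · exact hc.symm
  obtain ⟨x | i, j⟩ := v
  · rw [Subsingleton.elim x 0]
    exact hcenter j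
  · obtain ⟨⟨y, k⟩, hw, -⟩ := isPerfectMatching_iff.1 hM (.inr i, j)
    rcases boxProd_adj.1 hw.adj_sub with ⟨hadj, hjk⟩ | ⟨hjk, hy⟩
    · obtain y | y := y
      · obtain rfl : j = k := hjk
        rw [Subsingleton.elim y 0] at hw
        have := (isPerfectMatching_iff.1 hM (.inl 0, j)).unique hw.symm (hcenter j)
        simp at this
      · simp at hadj
    · obtain rfl : Sum.inr i = y := hy
      have hk : k = j + 1 := by
        have : j ≠ k := hjk
        omega
      rw [hk] at hw
      exact hw

theorem stmt16 (n : ℕ) (hn : 1 ≤ n) :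
    minForcingNumber (completeBipartiteGraph (Fin 1) (Fin n) □ (⊤ : SimpleGraph (Fin 2))) = 1 := by
  obtain ⟨m, rfl⟩ := Nat.exists_eq_add_of_le' hn
  set G := completeBipartiteGraph (Fin 1) (Fin (m + 1)) □ (⊤ : SimpleGraph (Fin 2))
  set M₀ : G.Subgraph := ofInvolutive prismFlip prismFlip_involutive (adj_prismFlip _)
  set M₁ : G.Subgraph := ofInvolutive starPrismSwap starPrismSwap_involutive adj_starPrismSwap
  have h₀ : M₀.IsPerfectMatching := isPerfectMatching_ofInvolutive ..
  have h₁ : M₁.IsPerfectMatching := isPerfectMatching_ofInvolutive ..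
  have hc : M₀.Adj (.inl 0, 0) (.inl 0, 1) := rfl
  have hne : M₀ ≠ M₁ := by
    intro h
    rw [h] at hc
    have : starPrismSwap (m := m) (.inl 0, 0) = (.inl 0, 1) := hc
    simp [starPrismSwap] at this
  have hle : forcingNumber G M₀ ≤ 1 := by
    refine Nat.sInf_le ⟨{s((.inl 0, 0), (.inl 0, 1))},
      Set.singleton_subset_iff.2 (Subgraph.mem_edgeSet.2 hc),
      Set.ncard_singleton _, fun M' hM' hsub => h₀.eq_of_adj_imp_s16 hM' ?_⟩
    rintro a _ rfl
    exact adj_prismFlip_of_adj_center hM'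
      (Subgraph.mem_edgeSet.1 (Set.singleton_subset_iff.1 hsub)) a
  have hmin : minForcingNumber G ≤ forcingNumber G M₀ := Nat.sInf_le ⟨M₀, h₀, rfl⟩
  refine le_antisymm (hmin.trans hle) ?_
  refine le_csInf (s := {c | ∃ M : G.Subgraph, M.IsPerfectMatching ∧ forcingNumber G M = c})
    ⟨_, M₀, h₀, rfl⟩ ?_
  rintro _ ⟨M, hM, rfl⟩
  exact one_le_forcingNumber hM h₀ h₁ hne
end
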